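/- arXiv:2503.15789 — 4 statements merged into one kernel-verified Lean document; each statement's English description precedes it below -/
import Mathlib

section
/- For every pair of integers k ≥ 1 and d ≥ 2 there exists a constant C > 0 (depending only on k and d) such that for every real number α and every positive integer n there exist integers b_1, …, b_k with 1 ≤ b_j ≤ n for all j and ‖ Σ_{j=1}^k b_j^{1/d} − α ‖ ≤ C · n^{−γ(k,d)}, where γ(k,d) = (d^{⌊log_d(k+1)⌋} − 1)/d and b_j^{1/d} denotes the real d-th root of b_j. -/
/-- Distance from a real number to the nearest integer. -/
noncomputable def distNearestInt (x : ℝ) : ℝ := |x - round x|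

theorem normalizedTrace_eq_zero_of_pow_eq {K : IntermediateField ℚ ℝ} [Algebra.IsIntegral ℚ K]
    {x : K} {d : ℕ} {q : ℚ} (hd : d ≠ 0) (hx : 0 < (x : ℝ)) (hq : (x : ℝ) ^ d = q) (hirr : Irrational (x : ℝ)) :
    Algebra.normalizedTrace ℚ K x = 0 := by
  have hint : IsIntegral ℚ x := Algebra.IsIntegral.isIntegral x
  set p := minpoly ℚ x with hp
  have hpmonic : p.Monic := minpoly.monic hint
  have hxq : x ^ d = algebraMap ℚ _ q := by
    apply Subtype.ext
    simpa using hq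
  have hdvd : p ∣ Polynomial.X ^ d - Polynomial.C q := minpoly.dvd _ _ (by simp [hxq])
  have hsplit := IsAlgClosed.splits (p.map (algebraMap ℚ ℂ))
  have hroots : ∀ z ∈ (p.map (algebraMap ℚ ℂ)).roots, ‖z‖ = x := by
    intro z hz
    rw [Polynomial.mem_roots', Polynomial.IsRoot.def, Polynomial.eval_map_algebraMap] at hz
    have h1 := Polynomial.aeval_eq_zero_of_dvd_aeval_eq_zero hdvd hz.2
    have h2 : z ^ d = ((x : ℝ) ^ d : ℝ) := by
      rw [hq]
      simpa [sub_eq_zero] using h1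
    have h3 : ‖z‖ ^ d = (x : ℝ) ^ d := by
      rw [← norm_pow, h2, Complex.norm_real, Real.norm_of_nonneg (by positivity)]
    exact (pow_left_inj₀ (norm_nonneg _) hx.le hd).1 h3
  have hnat : (p.map (algebraMap ℚ ℂ)).natDegree = p.natDegree := Polynomial.natDegree_map _
  have hconst : |(p.coeff 0 : ℝ)| = (x : ℝ) ^ p.natDegree := by
    have h1 := hsplit.coeff_zero_eq_prod_roots_of_monic (hpmonic.map _)
    have h2 := congrArg norm h1
    have h4 : ∀ s : Multiset ℂ, (∀ z ∈ s, ‖z‖ = x) → ‖s.prod‖ = (x : ℝ) ^ s.card := by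
      intro s
      induction s using Multiset.induction_on with
      | empty => simp
      | cons a s ih =>
        intro h
        simp only [Multiset.mem_cons, forall_eq_or_imp] at h
        rw [Multiset.prod_cons, norm_mul, h.1, ih h.2, Multiset.card_cons, pow_succ']
    rw [norm_mul, norm_pow, norm_neg, norm_one, one_pow, one_mul, h4 _ hroots,
      ← hsplit.natDegree_eq_card_roots, hnat, Polynomial.coeff_map] at h2
    rw [← h2]
    simp
  obtain ⟨a, ha⟩ : ∃ a : ℚ, (x : ℝ) ^ p.natDegree = a :=
    ⟨|p.coeff 0|, by rw [Rat.cast_abs, hconst]⟩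
  have hxa : x ^ p.natDegree = algebraMap ℚ K a := by
    apply Subtype.ext
    simpa using ha
  have hdeg : p = Polynomial.X ^ p.natDegree - Polynomial.C a := by
    have hpos : p.natDegree ≠ 0 := (minpoly.natDegree_pos hint).ne'
    symm
    apply minpoly.unique
    · exact Polynomial.monic_X_pow_sub_C _ hpos
    · simp [hxa]
    · intro r hr hr0
      rw [Polynomial.degree_X_pow_sub_C (Nat.pos_of_ne_zero hpos),
        ← Polynomial.degree_eq_natDegree hpmonic.ne_zero]
      exact minpoly.min _ _ hr hr0
  have hdeg2 : 2 ≤ p.natDegree := by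
    rw [minpoly.two_le_natDegree_iff hint]
    rintro ⟨r, hr⟩
    exact hirr ⟨r, by rw [← hr]; simp⟩
  rw [Algebra.normalizedTrace_minpoly, ← hp, Polynomial.nextCoeff_of_natDegree_pos (by omega)]
  have : p.coeff (p.natDegree - 1) = 0 := by
    have hne : p.natDegree - 1 ≠ 0 := by omega
    have hne' : p.natDegree - 1 ≠ p.natDegree := by omega
    generalize p.natDegree = r at hdeg hne hne'
    rw [hdeg, Polynomial.coeff_sub, Polynomial.coeff_X_pow, if_neg hne', Polynomial.coeff_C,
      if_neg hne, sub_zero]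
  simp [this]

theorem linearIndependent_of_irrational_div {ι : Type*} [Fintype ι] {θ : ι → ℝ} {d : ℕ}
    (hd : d ≠ 0) (hpos : ∀ i, 0 < θ i) (hpow : ∀ i, ∃ q : ℚ, θ i ^ d = q)
    (hirr : ∀ i j, i ≠ j → Irrational (θ i / θ j)) : LinearIndependent ℚ θ := by
  classical
  rw [Fintype.linearIndependent_iff]
  intro g hg j
  have : Algebra.IsIntegral ℚ (algebraicClosure ℚ ℝ) := ⟨fun x => by
    have hx : IsIntegral ℚ (x : ℝ) := mem_algebraicClosure_iff'.1 x.2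
    exact (isIntegral_algebraMap_iff (B := ℝ) Subtype.val_injective).1 hx⟩
  have hint : ∀ i, IsIntegral ℚ (θ i) := by
    intro i
    obtain ⟨q, hq⟩ := hpow i
    refine IsIntegral.of_pow (Nat.pos_of_ne_zero hd) ?_
    rw [hq]
    exact isIntegral_algebraMap (R := ℚ) (A := ℝ) (x := q)
  let T : ι → algebraicClosure ℚ ℝ := fun i =>
    ⟨θ i, mem_algebraicClosure_iff'.2 (hint i)⟩
  have hsum : ∑ i, g i • (T i / T j) = 0 := by
    apply Subtype.ext
    have : ∑ i, g i • (θ i / θ j) = 0 := by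
      simp only [div_eq_mul_inv, ← smul_mul_assoc, ← Finset.sum_mul, hg, zero_mul]
    simpa [T, IntermediateField.coe_sum] using this
  have h2 := congrArg (Algebra.normalizedTrace ℚ (algebraicClosure ℚ ℝ)) hsum
  rw [map_sum, map_zero, Finset.sum_eq_single j] at h2
  · have hone : T j / T j = algebraMap ℚ _ 1 := by
      rw [map_one]
      refine div_self fun h => (hpos j).ne' ?_
      simpa [T] using congrArg Subtype.val h
    rw [map_smul, hone, Algebra.normalizedTrace_algebraMap_apply_eq_self] at h2
    simpa using h2
  · intro i _ hij
    obtain ⟨q, hq⟩ := hpow i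
    obtain ⟨r, hr⟩ := hpow j
    rw [map_smul, normalizedTrace_eq_zero_of_pow_eq (d := d) (q := q / r) hd, smul_zero]
    · simpa [T] using div_pos (hpos i) (hpos j)
    · simp [T, div_pow, hq, hr]
    · simpa [T] using hirr i j hij
  · simp

theorem exists_small_integer_combination {ι : Type*} [Fintype ι] [DecidableEq ι] (θ : ι → ℝ)
    {i₀ : ι} (h₀ : θ i₀ = 1) {N : ℕ} (hN : 0 < N) :
    ∃ c : ι → ℤ, c ≠ 0 ∧ (∀ i, i ≠ i₀ → |(c i : ℝ)| ≤ N) ∧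
      |∑ i, (c i : ℝ) * θ i| ≤ 1 / (N : ℝ) ^ (Fintype.card ι - 1) := by
  set k := Fintype.card ι - 1 with hk
  have hcard : Fintype.card {i // i ≠ i₀} = k := by
    rw [hk, Fintype.card_subtype_compl, Fintype.card_subtype_eq]
  rcases Nat.eq_zero_or_pos k with h0 | hkpos
  · refine ⟨Pi.single i₀ 1, by simp, fun i hi => by simp [hi], ?_⟩
    rw [h0, Fintype.sum_eq_single i₀ (fun i hi => by simp [hi])]
    simp [h₀]
  have hNk : (0 : ℝ) < (N : ℝ) ^ k := by positivity
  let x : ({i // i ≠ i₀} → Fin (N + 1)) → ℝ := fun u => ∑ i, ((u i : ℕ) : ℝ) * θ i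
  have hlt : ∀ u, ⌊(N : ℝ) ^ k * Int.fract (x u)⌋₊ < N ^ k := by
    intro u
    rw [Nat.floor_lt (mul_nonneg hNk.le (Int.fract_nonneg _))]
    push_cast
    exact mul_lt_of_lt_one_right hNk (Int.fract_lt_one _)
  obtain ⟨u, v, huv, heq⟩ := Fintype.exists_ne_map_eq_of_card_lt
    (fun u => (⟨_, hlt u⟩ : Fin (N ^ k))) (by
      simp only [Fintype.card_fin, Fintype.card_fun, hcard]
      exact Nat.pow_lt_pow_left (Nat.lt_succ_self N) hkpos.ne')
  rw [Fin.mk.injEq] at heq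
  have hclose : |Int.fract (x u) - Int.fract (x v)| ≤ 1 / (N : ℝ) ^ k := by
    have h1 := Nat.floor_le (mul_nonneg hNk.le (Int.fract_nonneg (x u)))
    have h2 := Nat.floor_le (mul_nonneg hNk.le (Int.fract_nonneg (x v)))
    have h3 := Nat.lt_floor_add_one ((N : ℝ) ^ k * Int.fract (x u))
    have h4 := Nat.lt_floor_add_one ((N : ℝ) ^ k * Int.fract (x v))
    rw [heq] at h1 h3
    rw [le_div_iff₀ hNk, mul_comm, show ∀ y, (N : ℝ) ^ k * |y| = |(N : ℝ) ^ k * y| from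
      fun y => by rw [abs_mul, abs_of_pos hNk], abs_le]
    constructor <;> linarith
  refine ⟨fun i => if h : i ≠ i₀ then (u ⟨i, h⟩ : ℤ) - v ⟨i, h⟩ else ⌊x v⌋ - ⌊x u⌋, ?_, ?_, ?_⟩
  · intro hc
    apply huv
    funext i
    have h1 := congrFun hc i
    simp only [dif_pos i.2, Pi.zero_apply] at h1
    apply Fin.ext
    have : (u i : ℤ) = v i := by simpa [sub_eq_zero] using h1
    exact_mod_cast this
  · intro i hi
    simp only [dif_pos hi]
    have h1 : ((u ⟨i, hi⟩ : ℕ) : ℝ) ≤ N := by exact_mod_cast Nat.lt_succ_iff.1 (u ⟨i, hi⟩).2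
    have h2 : ((v ⟨i, hi⟩ : ℕ) : ℝ) ≤ N := by exact_mod_cast Nat.lt_succ_iff.1 (v ⟨i, hi⟩).2
    have h3 : (0 : ℝ) ≤ ((u ⟨i, hi⟩ : ℕ) : ℝ) := Nat.cast_nonneg _
    have h4 : (0 : ℝ) ≤ ((v ⟨i, hi⟩ : ℕ) : ℝ) := Nat.cast_nonneg _
    push_cast
    rw [abs_le]
    constructor <;> linarith
  · convert hclose using 2
    rw [Fintype.sum_eq_add_sum_subtype_ne _ i₀]
    have hsum : ∑ i : {i // i ≠ i₀}, (((if h : (i : ι) ≠ i₀ then (u ⟨i, h⟩ : ℤ) - v ⟨i, h⟩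
        else ⌊x v⌋ - ⌊x u⌋ : ℤ)) : ℝ) * θ i = x u - x v := by
      simp only [x, ← Finset.sum_sub_distrib]
      refine Finset.sum_congr rfl fun i _ => ?_
      rw [dif_pos i.2]
      push_cast
      ring
    rw [hsum]
    simp only [ne_eq, not_true_eq_false, dite_false, h₀, Int.fract]
    push_cast
    ring

theorem exists_integer_combination_close {ι : Type*} [Fintype ι] [DecidableEq ι] {θ : ι → ℝ}
    (hθ : LinearIndependent ℚ θ) {i₀ : ι} (h₀ : θ i₀ = 1) (m : ι → ι → ι → ℤ)
    (hm : ∀ i j, θ i * θ j = ∑ l, (m i j l : ℝ) * θ l) :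
    ∃ C : ℕ, ∀ (α : ℝ) (N : ℕ), 0 < N → ∃ c : ι → ℤ,
      (∀ i, i ≠ i₀ → |(c i : ℝ)| ≤ C * N) ∧
        |∑ i, (c i : ℝ) * θ i - α| ≤ C / (N : ℝ) ^ (Fintype.card ι - 1) := by
  set B : ℝ := ∑ i, |θ i| with hB
  have hB0 : 0 ≤ B := Finset.sum_nonneg fun i _ => abs_nonneg _
  set A : ℝ := ∑ l, ∑ j, ∑ i, |(m i j l : ℝ)| with hA
  have hA0 : 0 ≤ A := by positivity
  refine ⟨⌈(1 + B) * A + B⌉₊, fun α N hN => ?_⟩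
  have hC := Nat.le_ceil ((1 + B) * A + B)
  set C : ℝ := (⌈(1 + B) * A + B⌉₊ : ℝ)
  set k := Fintype.card ι - 1 with hk
  have hN1 : (1 : ℝ) ≤ N := by exact_mod_cast hN
  have hNk : (0 : ℝ) < (N : ℝ) ^ k := by positivity
  obtain ⟨c, hc0, hcN, hcs⟩ := exists_small_integer_combination θ h₀ hN
  set ω : ℝ := ∑ i, (c i : ℝ) * θ i with hω
  have hli := Fintype.linearIndependent_iff.1 hθ
  have hω0 : ω ≠ 0 := by
    intro h
    apply hc0
    funext i
    have := hli (fun i => (c i : ℚ)) (by simpa [Rat.smul_def, hω] using h) i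
    exact_mod_cast this
  have hcB : ∀ i, |(c i : ℝ)| ≤ (1 + B) * N := by
    intro i
    by_cases hi : i = i₀
    · subst hi
      have h1 : (c i : ℝ) = ω - ∑ j : {j // j ≠ i}, (c j : ℝ) * θ j := by
        rw [hω, Fintype.sum_eq_add_sum_subtype_ne _ i, h₀]
        ring
      have h2 : |∑ j : {j // j ≠ i}, (c j : ℝ) * θ j| ≤ B * N := by
        calc _ ≤ ∑ j : {j // j ≠ i}, |(c j : ℝ) * θ j| := Finset.abs_sum_le_sum_abs _ _
          _ ≤ ∑ j : {j // j ≠ i}, N * |θ j| := Finset.sum_le_sum fun j _ => by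
              rw [abs_mul]
              exact mul_le_mul_of_nonneg_right (hcN j j.2) (abs_nonneg _)
          _ = N * ∑ j : {j // j ≠ i}, |θ j| := by rw [Finset.mul_sum]
          _ ≤ N * B := by
              rw [hB, Fintype.sum_eq_add_sum_subtype_ne _ i]
              gcongr
              linarith [abs_nonneg (θ i)]
          _ = B * N := mul_comm _ _
      have h3 : 1 / (N : ℝ) ^ k ≤ 1 := by
        rw [div_le_one hNk]
        exact one_le_pow₀ hN1
      rw [h1]
      calc _ ≤ |ω| + |∑ j : {j // j ≠ i}, (c j : ℝ) * θ j| := abs_sub _ _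
        _ ≤ (1 + B) * N := by linarith
    · refine (hcN i hi).trans ?_
      nlinarith
  let V : Matrix ι ι ℤ := fun j l => ∑ i, c i * m i j l
  have hV : ∀ j, ∑ l, (V j l : ℝ) * θ l = ω * θ j := by
    intro j
    simp only [V, hω, Finset.sum_mul, Int.cast_sum, Int.cast_mul]
    rw [Finset.sum_comm]
    refine Finset.sum_congr rfl fun i _ => ?_
    rw [mul_assoc, hm, Finset.mul_sum]
    refine Finset.sum_congr rfl fun l _ => ?_
    ring
  have hdet : (V.map (Int.cast : ℤ → ℚ)).det ≠ 0 := by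
    intro h
    obtain ⟨w, hw0, hw⟩ := Matrix.exists_vecMul_eq_zero_iff.2 h
    apply hw0
    have h1 : ω * ∑ j, (w j : ℝ) * θ j = 0 := by
      have h2 : ∀ l, ∑ j, (w j : ℝ) * V j l = 0 := by
        intro l
        have := congrFun hw l
        simp only [Matrix.vecMul, dotProduct, Matrix.map_apply, Pi.zero_apply] at this
        exact_mod_cast this
      calc ω * ∑ j, (w j : ℝ) * θ j = ∑ j, (w j : ℝ) * ∑ l, (V j l : ℝ) * θ l := by
            rw [Finset.mul_sum]
            refine Finset.sum_congr rfl fun j _ => ?_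
            rw [hV]
            ring
        _ = ∑ l, (∑ j, (w j : ℝ) * V j l) * θ l := by
            simp only [Finset.mul_sum, Finset.sum_mul]
            rw [Finset.sum_comm]
            simp only [mul_assoc]
        _ = 0 := by simp [h2]
    funext j
    exact hli w (by simpa [Rat.smul_def] using (mul_eq_zero.1 h1).resolve_left hω0) j
  have hdetR : IsUnit (V.map (Int.cast : ℤ → ℝ)).det := by
    rw [isUnit_iff_ne_zero]
    have e1 : (V.map (Int.cast : ℤ → ℚ)).det = (V.det : ℚ) := (Int.cast_det V).symm
    have e2 : (V.map (Int.cast : ℤ → ℝ)).det = (V.det : ℝ) := (Int.cast_det V).symm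
    rw [e1] at hdet
    rw [e2]
    exact_mod_cast hdet
  obtain ⟨t, ht⟩ : ∃ t : ι → ℝ, ∀ l, ∑ j, t j * V j l = Pi.single (M := fun _ => ℝ) i₀ α l := by
    refine ⟨Matrix.vecMul (Pi.single i₀ α) (V.map (Int.cast : ℤ → ℝ))⁻¹, fun l => ?_⟩
    have : Matrix.vecMul (Matrix.vecMul (Pi.single i₀ α) (V.map (Int.cast : ℤ → ℝ))⁻¹)
        (V.map (Int.cast : ℤ → ℝ)) = Pi.single i₀ α := by
      rw [Matrix.vecMul_vecMul, Matrix.nonsing_inv_mul _ hdetR, Matrix.vecMul_one]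
    exact congrFun this l
  have hround : ∀ j, |(round (t j) : ℝ) - t j| ≤ 1 := by
    intro j
    rw [abs_sub_comm]
    exact (abs_sub_round _).trans (by norm_num)
  have hVA : ∀ l, ∑ j, |(V j l : ℝ)| ≤ (1 + B) * A * N := by
    intro l
    calc _ ≤ ∑ j, ∑ i, (1 + B) * N * |(m i j l : ℝ)| := by
          refine Finset.sum_le_sum fun j _ => ?_
          simp only [V, Int.cast_sum, Int.cast_mul]
          refine (Finset.abs_sum_le_sum_abs _ _).trans (Finset.sum_le_sum fun i _ => ?_)
          rw [abs_mul]
          exact mul_le_mul_of_nonneg_right (hcB i) (abs_nonneg _)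
      _ = (1 + B) * N * ∑ j, ∑ i, |(m i j l : ℝ)| := by simp only [Finset.mul_sum]
      _ ≤ (1 + B) * N * A := by
          gcongr
          exact Finset.single_le_sum (f := fun l => ∑ j, ∑ i, |(m i j l : ℝ)|)
            (fun l _ => by positivity) (Finset.mem_univ l)
      _ = (1 + B) * A * N := by ring
  refine ⟨fun l => ∑ j, round (t j) * V j l, fun l hl => ?_, ?_⟩
  · have h1 : ((∑ j, round (t j) * V j l : ℤ) : ℝ) = ∑ j, ((round (t j) : ℝ) - t j) * V j l := by
      have := ht l
      rw [Pi.single_eq_of_ne hl] at this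
      simp only [sub_mul, Finset.sum_sub_distrib, this]
      push_cast
      ring
    rw [h1]
    calc _ ≤ ∑ j, |((round (t j) : ℝ) - t j) * V j l| := Finset.abs_sum_le_sum_abs _ _
      _ ≤ ∑ j, |(V j l : ℝ)| := Finset.sum_le_sum fun j _ => by
          rw [abs_mul]
          exact mul_le_of_le_one_left (abs_nonneg _) (hround j)
      _ ≤ (1 + B) * A * N := hVA l
      _ ≤ C * N := by
          gcongr
          linarith
  · have hα : α = ∑ j, t j * (ω * θ j) := by
      calc α = ∑ l, Pi.single (M := fun _ => ℝ) i₀ α l * θ l := by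
            rw [Fintype.sum_eq_single i₀ (fun i hi => by simp [hi])]
            simp [h₀]
        _ = ∑ j, t j * ∑ l, (V j l : ℝ) * θ l := by
            simp only [← ht, Finset.mul_sum, Finset.sum_mul]
            rw [Finset.sum_comm]
            simp only [mul_assoc]
        _ = _ := by simp only [hV]
    have h1 : ∑ l, ((∑ j, round (t j) * V j l : ℤ) : ℝ) * θ l - α
        = ∑ j, ((round (t j) : ℝ) - t j) * (ω * θ j) := by
      simp only [sub_mul, Finset.sum_sub_distrib]
      rw [← hα]
      simp only [← hV, Int.cast_sum, Int.cast_mul, Finset.mul_sum, Finset.sum_mul]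
      rw [Finset.sum_comm]
      simp only [mul_assoc]
    rw [h1]
    calc _ ≤ ∑ j, |((round (t j) : ℝ) - t j) * (ω * θ j)| := Finset.abs_sum_le_sum_abs _ _
      _ ≤ ∑ j, 1 / (N : ℝ) ^ k * |θ j| := Finset.sum_le_sum fun j _ => by
          rw [abs_mul, abs_mul]
          refine (mul_le_of_le_one_left (by positivity) (hround j)).trans ?_
          gcongr
      _ = B / (N : ℝ) ^ k := by
          rw [← Finset.mul_sum, hB]
          ring
      _ ≤ C / (N : ℝ) ^ k := by
          gcongr
          linarith [mul_nonneg (add_nonneg zero_le_one hB0) hA0]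

/-- The monomial with exponent vector `f` in the first `m` primes. -/
noncomputable def primeMonomial {m : ℕ} (f : Fin m → ℕ) : ℕ :=
  ∏ i : Fin m, Nat.nth Nat.Prime i ^ f i

theorem primeMonomial_pos {m : ℕ} (f : Fin m → ℕ) : 0 < primeMonomial f :=
  Finset.prod_pos fun i _ => pow_pos (Nat.prime_nth_prime i).pos _

theorem padicValNat_primeMonomial {m : ℕ} (f : Fin m → ℕ) (i : Fin m) :
    padicValNat (Nat.nth Nat.Prime i) (primeMonomial f) = f i := by
  have hp := Nat.prime_nth_prime (i : ℕ)
  have hinj : Function.Injective (Nat.nth Nat.Prime) :=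
    Nat.nth_injective Nat.infinite_setOfPred_prime
  rw [← Nat.factorization_def _ hp, primeMonomial,
    Nat.factorization_prod fun (j : Fin m) _ => pow_ne_zero _ (Nat.prime_nth_prime j).ne_zero,
    Finsupp.finsetSum_apply, Fintype.sum_eq_single i]
  · rw [hp.factorization_pow, Finsupp.single_eq_same]
  · intro j hj
    rw [(Nat.prime_nth_prime j).factorization_pow, Finsupp.single_eq_of_ne]
    intro h
    exact hj (Fin.ext (hinj h)).symm

theorem primeMonomial_add {m : ℕ} (f g : Fin m → ℕ) :
    primeMonomial (f + g) = primeMonomial f * primeMonomial g := by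
  simp [primeMonomial, pow_add, Finset.prod_mul_distrib]

theorem primeMonomial_nsmul {m : ℕ} (d : ℕ) (f : Fin m → ℕ) :
    primeMonomial (d • f) = primeMonomial f ^ d := by
  simp [primeMonomial, mul_comm d, pow_mul, Finset.prod_pow]

theorem irrational_primeMonomial_rpow_div {m d : ℕ} (hd : d ≠ 0) {f g : Fin m → Fin d}
    (hfg : f ≠ g) :
    Irrational ((primeMonomial (fun i => f i) : ℝ) ^ (d : ℝ)⁻¹ /
      (primeMonomial (fun i => g i) : ℝ) ^ (d : ℝ)⁻¹) := by
  set P := primeMonomial (fun i => (f i : ℕ)) with hP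
  set Q := primeMonomial (fun i => (g i : ℕ)) with hQ
  have hP0 : P ≠ 0 := (primeMonomial_pos _).ne'
  have hQ0 : Q ≠ 0 := (primeMonomial_pos _).ne'
  rintro ⟨q, hq⟩
  apply hfg
  have h1 : (q : ℝ) ^ d = P / Q := by
    rw [hq, div_pow, Real.rpow_inv_natCast_pow (Nat.cast_nonneg _) hd,
      Real.rpow_inv_natCast_pow (Nat.cast_nonneg _) hd]
  have h2 : q ^ d = (P : ℚ) / Q := by
    rw [← Rat.cast_inj (α := ℝ)]
    push_cast
    exact h1
  funext i
  have : Fact (Nat.Prime (Nat.nth Nat.Prime i)) := ⟨Nat.prime_nth_prime i⟩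
  have h3 := congrArg (padicValRat (Nat.nth Nat.Prime i)) h2
  rw [padicValRat.pow, padicValRat.div (by exact_mod_cast hP0) (by exact_mod_cast hQ0),
    padicValRat.of_nat, padicValRat.of_nat, hP, hQ, padicValNat_primeMonomial,
    padicValNat_primeMonomial] at h3
  have h4 : (d : ℤ) ∣ (f i : ℤ) - g i := ⟨_, h3.symm⟩
  have h5 := Int.eq_zero_of_abs_lt_dvd h4 (by rw [abs_lt]; constructor <;> omega)
  exact Fin.ext (by omega)

theorem primeMonomial_rpow_mul {m d : ℕ} [NeZero d] (f g : Fin m → Fin d) :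
    (primeMonomial (fun i => f i) : ℝ) ^ (d : ℝ)⁻¹ * (primeMonomial (fun i => g i) : ℝ) ^ (d : ℝ)⁻¹
      = primeMonomial (fun i => (f i + g i : ℕ) / d) *
        (primeMonomial (fun i => (f + g) i) : ℝ) ^ (d : ℝ)⁻¹ := by
  have h : (fun i => (f i : ℕ)) + (fun i => (g i : ℕ)) =
      d • (fun i => (f i + g i : ℕ) / d) + fun i => ((f + g) i : ℕ) := by
    funext i
    simp [Fin.val_add, Nat.div_add_mod]
  rw [← Real.mul_rpow (Nat.cast_nonneg _) (Nat.cast_nonneg _), ← Nat.cast_mul,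
    ← primeMonomial_add, h, primeMonomial_add, primeMonomial_nsmul, Nat.cast_mul, Nat.cast_pow,
    Real.mul_rpow (by positivity) (Nat.cast_nonneg _),
    Real.pow_rpow_inv_natCast (Nat.cast_nonneg _) (NeZero.ne d)]

theorem distNearestInt_le (x : ℝ) (z : ℤ) : distNearestInt x ≤ |x - z| := round_le x z

theorem distNearestInt_le_half (x : ℝ) : distNearestInt x ≤ 1 / 2 := abs_sub_round x

theorem distNearestInt_add_natCast (x : ℝ) (r : ℕ) :
    distNearestInt (x + r) = distNearestInt x := by
  simp [distNearestInt, round_add_natCast]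

theorem exists_sum_rpow_inv_close (m : ℕ) {d : ℕ} (hd : d ≠ 0) :
    ∃ D : ℕ, 0 < D ∧ ∀ (α : ℝ) (N : ℕ), 0 < N → ∃ b : Fin (d ^ m - 1) → ℕ,
      (∀ i, 1 ≤ b i ∧ b i ≤ (D * N) ^ d) ∧
        distNearestInt ((∑ i, (b i : ℝ) ^ (d : ℝ)⁻¹) - α) ≤ D / (N : ℝ) ^ (d ^ m - 1) := by
  have : NeZero d := ⟨hd⟩
  let θ : (Fin m → Fin d) → ℝ := fun f => (primeMonomial (fun i => f i) : ℝ) ^ (d : ℝ)⁻¹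
  have hθpos : ∀ f, 0 < θ f := fun f =>
    Real.rpow_pos_of_pos (Nat.cast_pos.2 (primeMonomial_pos _)) _
  have hθpow : ∀ f, θ f ^ d = primeMonomial (fun i => f i) := fun f =>
    Real.rpow_inv_natCast_pow (Nat.cast_nonneg _) hd
  have hli : LinearIndependent ℚ θ := linearIndependent_of_irrational_div hd hθpos
    (fun f => ⟨primeMonomial (fun i => f i), by rw [hθpow]; simp⟩)
    (fun f g hfg => irrational_primeMonomial_rpow_div hd hfg)
  have h0 : θ 0 = 1 := by simp [θ, primeMonomial]
  obtain ⟨C, hC⟩ := exists_integer_combination_close hli h0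
    (fun f g l => if l = f + g then (primeMonomial (fun i => (f i + g i : ℕ) / d) : ℤ) else 0)
    (fun f g => by
      rw [Fintype.sum_eq_single (f + g) (fun l hl => by simp [hl])]
      simpa [θ] using primeMonomial_rpow_mul f g)
  have hcard : Fintype.card (Fin m → Fin d) = d ^ m := by simp
  rw [hcard] at hC
  let e : Fin (d ^ m - 1) ≃ {f : Fin m → Fin d // f ≠ 0} :=
    (Fintype.equivFinOfCardEq (by
      rw [Fintype.card_subtype_compl, Fintype.card_subtype_eq, hcard])).symm
  set Q := ∑ f : Fin m → Fin d, primeMonomial (fun i => f i) with hQ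
  have hleQ : ∀ f : Fin m → Fin d, primeMonomial (fun i => f i) ≤ Q := fun f =>
    Finset.single_le_sum (f := fun f : Fin m → Fin d => primeMonomial (fun i => f i))
      (fun _ _ => Nat.zero_le _) (Finset.mem_univ f)
  have hQ1 : 1 ≤ Q := (primeMonomial_pos _).trans_le (hleQ 0)
  refine ⟨(2 * C + 1) * Q, by positivity, fun α N hN => ?_⟩
  obtain ⟨c, hcN, hc⟩ := hC (α - ∑ f : {f : Fin m → Fin d // f ≠ 0}, ((C * N + 1 : ℕ) : ℝ) * θ f)
    N hN
  have hshift : ∀ f, f ≠ 0 → ∃ u : ℕ, (u : ℤ) = c f + (C * N + 1 : ℕ) ∧ 1 ≤ u ∧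
      u ≤ (2 * C + 1) * N := by
    intro f hf
    have h1 : |c f| ≤ C * N := by exact_mod_cast hcN f hf
    rw [abs_le] at h1
    refine ⟨(c f + (C * N + 1 : ℕ)).toNat, ?_, ?_, ?_⟩
    · push_cast
      omega
    · push_cast
      omega
    · zify at hN ⊢
      rw [Int.toNat_of_nonneg (by omega)]
      linarith
  choose! u hu hu1 huN using hshift
  refine ⟨fun i => u (e i) ^ d * primeMonomial (fun j => (e i : Fin m → Fin d) j),
    fun i => ⟨?_, ?_⟩, ?_⟩
  · exact Nat.mul_pos (pow_pos (hu1 _ (e i).2) _) (primeMonomial_pos _)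
  · calc _ ≤ ((2 * C + 1) * N) ^ d * Q ^ d := by
          exact Nat.mul_le_mul (Nat.pow_le_pow_left (huN _ (e i).2) d)
            ((hleQ _).trans (Nat.le_self_pow hd Q))
      _ = _ := by rw [← mul_pow]; ring
  · have hroot : ∀ i, ((u (e i) ^ d * primeMonomial (fun j => (e i : Fin m → Fin d) j) : ℕ) : ℝ) ^
        (d : ℝ)⁻¹ = u (e i) * θ (e i) := by
      intro i
      rw [Nat.cast_mul, Nat.cast_pow, Real.mul_rpow (by positivity) (Nat.cast_nonneg _),
        Real.pow_rpow_inv_natCast (Nat.cast_nonneg _) hd]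
    simp only [hroot]
    rw [Equiv.sum_comp e (fun f => (u f : ℝ) * θ f)]
    refine (distNearestInt_le _ (-c 0)).trans ?_
    have hsum : ∑ f : {f : Fin m → Fin d // f ≠ 0}, (u f : ℝ) * θ f - α - ((-c 0 : ℤ) : ℝ) =
        ∑ f, (c f : ℝ) * θ f -
          (α - ∑ f : {f : Fin m → Fin d // f ≠ 0}, ((C * N + 1 : ℕ) : ℝ) * θ f) := by
      rw [Fintype.sum_eq_add_sum_subtype_ne _ (0 : Fin m → Fin d), h0]
      have : ∀ f : {f : Fin m → Fin d // f ≠ 0},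
          (u f : ℝ) * θ f = c f * θ f + ((C * N + 1 : ℕ) : ℝ) * θ f := by
        intro f
        have := hu f f.2
        have h2 : (u f : ℝ) = c f + ((C * N + 1 : ℕ) : ℝ) := by exact_mod_cast this
        rw [h2]
        ring
      simp only [this, Finset.sum_add_distrib]
      push_cast
      ring
    rw [hsum]
    refine hc.trans ?_
    gcongr
    nlinarith

theorem stmt_0 (k d : ℕ) (hk : 1 ≤ k) (hd : 2 ≤ d) :
    ∃ C : ℝ, 0 < C ∧ ∀ (α : ℝ) (n : ℕ), 0 < n →
      ∃ b : Fin k → ℕ, (∀ j, 1 ≤ b j ∧ b j ≤ n) ∧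
        distNearestInt ((∑ j, (b j : ℝ) ^ ((d : ℝ)⁻¹)) - α) ≤
          C * (n : ℝ) ^
            (-(((d : ℝ) ^ (⌊Real.logb d ((k : ℝ) + 1)⌋) - 1) / (d : ℝ))) := by
  have hd0 : d ≠ 0 := by omega
  have hdR : (0 : ℝ) < d := by positivity
  set m := Nat.log d (k + 1) with hm
  have hfloor : ⌊Real.logb d ((k : ℝ) + 1)⌋ = (m : ℤ) := by
    rw [← Nat.cast_succ, Real.floor_logb_natCast (Nat.cast_nonneg _), Int.log_natCast]
  have hmk : d ^ m ≤ k + 1 := Nat.pow_log_le_self d (Nat.succ_ne_zero k)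
  have hdm : 1 ≤ d ^ m := Nat.one_le_pow _ _ (by omega)
  rw [hfloor, zpow_natCast]
  obtain ⟨D, hD, H⟩ := exists_sum_rpow_inv_close m hd0
  set K := d ^ m - 1 with hK
  have hexp : (d : ℝ) ^ m - 1 = K := by
    rw [hK, Nat.cast_sub hdm]
    push_cast
    ring
  rw [hexp]
  have hDR : (1 : ℝ) ≤ D := by exact_mod_cast hD
  refine ⟨D * (2 * D) ^ K, by positivity, fun α n hn => ?_⟩
  have hnR : (0 : ℝ) < n := Nat.cast_pos.2 hn
  set s : ℝ := (n : ℝ) ^ (d : ℝ)⁻¹ with hs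
  have hs0 : 0 < s := Real.rpow_pos_of_pos hnR _
  have hsd : s ^ d = n := Real.rpow_inv_natCast_pow hnR.le hd0
  have hpow : (n : ℝ) ^ (-((K : ℝ) / d)) = 1 / s ^ K := by
    rw [Real.rpow_neg hnR.le, hs, ← Real.rpow_natCast, ← Real.rpow_mul hnR.le, one_div,
      div_eq_inv_mul]
  rw [hpow]
  set N := ⌊s / D⌋₊ with hNdef
  rcases Nat.eq_zero_or_pos N with hN | hN
  · refine ⟨fun _ => 1, fun _ => ⟨le_rfl, hn⟩, (distNearestInt_le_half _).trans ?_⟩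
    have h1 : s < D := by
      rw [hNdef, Nat.floor_eq_zero, div_lt_one (by positivity)] at hN
      exact hN
    have h2 : s ^ K ≤ (2 * D) ^ K := by
      gcongr
      linarith
    rw [mul_one_div, le_div_iff₀ (by positivity)]
    nlinarith [pow_pos hs0 K]
  · obtain ⟨b, hb, hclose⟩ := H α N hN
    have hNs : D * (N : ℝ) ≤ s := by
      rw [mul_comm, ← le_div_iff₀ (by positivity)]
      exact Nat.floor_le (by positivity)
    have hsN : s ≤ 2 * D * N := by
      have h1 := Nat.lt_floor_add_one (s / D)
      rw [div_lt_iff₀ (by positivity)] at h1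
      have h2 : (1 : ℝ) ≤ N := by exact_mod_cast hN
      nlinarith
    have hDN : (D * N) ^ d ≤ n := by
      have : ((D * N : ℝ)) ^ d ≤ n := by
        rw [← hsd]
        gcongr
      exact_mod_cast this
    let e : Fin k ≃ Fin K ⊕ Fin (k - K) :=
      (finCongr (by omega)).trans finSumFinEquiv.symm
    refine ⟨fun j => Sum.elim b (fun _ => 1) (e j), fun j => ?_, ?_⟩
    · dsimp only
      rcases e j with i | i
      · exact ⟨(hb i).1, (hb i).2.trans hDN⟩
      · exact ⟨le_rfl, hn⟩
    · rw [Equiv.sum_comp e (fun i => ((Sum.elim b (fun _ => 1) i : ℕ) : ℝ) ^ (d : ℝ)⁻¹),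
        Fintype.sum_sum_type]
      simp only [Sum.elim_inl, Sum.elim_inr, Nat.cast_one, Real.one_rpow, Finset.sum_const,
        Finset.card_univ, Fintype.card_fin, nsmul_eq_mul, mul_one]
      rw [add_sub_right_comm, distNearestInt_add_natCast]
      refine hclose.trans ?_
      rw [mul_one_div, div_le_div_iff₀ (by positivity) (by positivity), mul_assoc, ← mul_pow]
      gcongr
end

section
/- Let θ > 0 be a real number. There exists a constant D > 0 (depending only on θ) such that for every real x ≥ 1 there exist nonnegative integers u, v with x ≤ u^θ + v^θ ≤ x + D · x^{Ψ(θ)}, where Ψ(θ) = 1 − 3/(2θ) if 0 < θ < 1, Ψ(1) = 0, Ψ(θ) = 1 − 3/(2θ) if 1 < θ < 2, and Ψ(θ) = 1 − 2/θ + 1/θ² if θ ≥ 2. -/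
/-- The exponent Ψ(θ) from Theorem 1.5. -/
noncomputable def Psi (θ : ℝ) : ℝ :=
  if θ < 1 then 1 - 3 / (2 * θ)
  else if θ = 1 then 0
  else if θ < 2 then 1 - 3 / (2 * θ)
  else 1 - 2 / θ + 1 / θ ^ 2

theorem rpow_le_rpow_abs_mul_rpow {L a b : ℝ} (e : ℝ) (ha : 0 < a) (hb : 0 < b)
    (hL : 0 < L) (hab : a ≤ L * b) (hba : b ≤ L * a) : a ^ e ≤ L ^ |e| * b ^ e := by
  rcases le_total 0 e with he | he
  · rw [abs_of_nonneg he, ← Real.mul_rpow hL.le hb.le]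
    exact Real.rpow_le_rpow ha.le hab he
  · have h : (L * a) ^ e ≤ b ^ e := Real.rpow_le_rpow_of_nonpos hb hba he
    rw [Real.mul_rpow hL.le ha.le] at h
    rw [abs_of_nonpos he]
    calc a ^ e = L ^ (-e) * (L ^ e * a ^ e) := by
          rw [← mul_assoc, ← Real.rpow_add hL]; simp
      _ ≤ L ^ (-e) * b ^ e := by gcongr

theorem exists_add_rpow_sub_rpow {p a d : ℝ} (ha : 0 ≤ a) (hd : 0 < d) (h : 0 < a ∨ 0 ≤ p) :
    ∃ z ∈ Set.Ioo a (a + d), (a + d) ^ p - a ^ p = p * z ^ (p - 1) * d := by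
  obtain ⟨z, hz, hz'⟩ := exists_hasDerivAt_eq_slope (fun t : ℝ => t ^ p)
    (fun t => p * t ^ (p - 1)) (show a < a + d by linarith)
    (by
      intro t ht
      refine (Real.continuousAt_rpow_const t p ?_).continuousWithinAt
      exact h.imp (fun h => (h.trans_le ht.1).ne') id)
    (fun t ht => Real.hasDerivAt_rpow_const (Or.inl (ha.trans_lt ht.1).ne'))
  refine ⟨z, hz, ?_⟩
  have hd' : a + d - a ≠ 0 := by simpa using hd.ne'
  rw [eq_div_iff hd'] at hz'
  linarith

theorem exists_rpow_second_difference {p a d : ℝ} (ha : 0 < a) (hd : 0 < d) :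
    ∃ z ∈ Set.Ioo a (a + 1 + d),
      ((a + 1 + d) ^ p - (a + 1) ^ p) - ((a + d) ^ p - a ^ p) =
        p * (p - 1) * z ^ (p - 2) * d := by
  have hderiv : ∀ t : ℝ, 0 < t → HasDerivAt (fun t : ℝ => (t + d) ^ p - t ^ p)
      (p * (t + d) ^ (p - 1) - p * t ^ (p - 1)) t := fun t ht =>
    ((Real.hasDerivAt_rpow_const (Or.inl (add_pos ht hd).ne')).comp_add_const t d).sub
      (Real.hasDerivAt_rpow_const (Or.inl ht.ne'))
  obtain ⟨y, hy, hy'⟩ := exists_hasDerivAt_eq_slope (fun t : ℝ => (t + d) ^ p - t ^ p)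
    (fun t => p * (t + d) ^ (p - 1) - p * t ^ (p - 1)) (show a < a + 1 by linarith)
    (fun t ht => (hderiv t (ha.trans_le ht.1)).continuousAt.continuousWithinAt)
    (fun t ht => hderiv t (ha.trans ht.1))
  have hy0 : 0 < y := ha.trans hy.1
  obtain ⟨z, hz, hz'⟩ := exists_add_rpow_sub_rpow (p := p - 1) hy0.le hd (Or.inl hy0)
  refine ⟨z, ⟨hy.1.trans hz.1, by linarith [hz.2, hy.2]⟩, ?_⟩
  rw [add_sub_cancel_left, div_one] at hy'
  rw [← hy', ← mul_sub, hz', show p - 1 - 1 = p - 2 by ring]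
  ring

theorem add_one_rpow_sub_rpow_le {p m : ℝ} (hp : 0 < p) (hm : 1 ≤ m) :
    (m + 1) ^ p - m ^ p ≤ p * 2 ^ |p - 1| * m ^ (p - 1) := by
  obtain ⟨z, hz, h⟩ := exists_add_rpow_sub_rpow (p := p) (a := m) (d := 1) (by linarith)
    one_pos (Or.inr hp.le)
  rw [h, mul_one, mul_assoc]
  gcongr
  exact rpow_le_rpow_abs_mul_rpow _ (by linarith [hz.1]) (by linarith) two_pos
    (by linarith [hz.2]) (by linarith [hz.1])

theorem exists_crossing {h : ℕ → ℝ} {A B r : ℝ} {J : ℕ} (h0 : h 0 = 0) (hA : 0 < A)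
    (hB : 0 ≤ B) (hlow : ∀ j < J, A * (2 * j + 1) ≤ h (j + 1) - h j)
    (hup : ∀ j < J, h (j + 1) - h j ≤ B * (2 * j + 1)) (hr0 : 0 ≤ r)
    (hr : r ≤ A * (J : ℝ) ^ 2) :
    ∃ i ≤ J, ∃ k ≤ J, h i ≤ r ∧ r ≤ h k ∧ h k - h i ≤ B * (2 * √(r / A) + 1) := by
  have hsq : ∀ j ≤ J, A * (j : ℝ) ^ 2 ≤ h j := by
    intro j
    induction j with
    | zero => simp [h0]
    | succ j ih =>
      intro hj
      have h1 := ih (by omega)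
      have h2 := hlow j (by omega)
      push_cast
      nlinarith
  have hex : ∃ k, r ≤ h k := ⟨J, hr.trans (hsq J le_rfl)⟩
  classical
  obtain ⟨k, hk, hmin⟩ : ∃ k, r ≤ h k ∧ ∀ j < k, h j < r :=
    ⟨Nat.find hex, Nat.find_spec hex, fun j hj => not_le.mp (Nat.find_min hex hj)⟩
  have hkJ : k ≤ J := by
    by_contra! hlt
    exact absurd (hr.trans (hsq J le_rfl)) (not_le.mpr (hmin J hlt))
  cases k with
  | zero =>
    refine ⟨0, hkJ, 0, hkJ, h0.le.trans hr0, hk, ?_⟩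
    rw [sub_self]
    positivity
  | succ j =>
    refine ⟨j, by omega, j + 1, hkJ, (hmin j (by omega)).le, hk, (hup j (by omega)).trans ?_⟩
    have hj : (j : ℝ) ≤ √(r / A) := by
      apply Real.le_sqrt_of_sq_le
      rw [le_div_iff₀ hA]
      linarith [hsq j (by omega), hmin j (by omega)]
    gcongr

/-- Pairs `(m + j, m - j)` close to the diagonal give sums of two `p`-th powers which
approximate any target at distance `O(m ^ (p - 1))` from `2 * m ^ p` on its proper side,
within `O(m ^ (p - 3 / 2))`. -/
theorem exists_near_diagonal {p σ C : ℝ} (hp : 0 < p) (hσ : 0 < σ * (p - 1)) (hC : 0 < C) :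
    ∃ K > 0, ∃ M : ℝ, ∀ m : ℕ, 2 ≤ m → M ≤ m → ∀ r : ℝ, 0 ≤ r → r ≤ C * (m : ℝ) ^ (p - 1) →
      ∃ u v u' v' : ℕ,
        σ * ((u : ℝ) ^ p + (v : ℝ) ^ p - 2 * (m : ℝ) ^ p) ≤ r ∧
        r ≤ σ * ((u' : ℝ) ^ p + (v' : ℝ) ^ p - 2 * (m : ℝ) ^ p) ∧
        σ * ((u' : ℝ) ^ p + (v' : ℝ) ^ p - 2 * (m : ℝ) ^ p) -
          σ * ((u : ℝ) ^ p + (v : ℝ) ^ p - 2 * (m : ℝ) ^ p) ≤ K * (m : ℝ) ^ (p - 3 / 2) := by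
  set c : ℝ := p * (σ * (p - 1)) with hc
  have hc0 : 0 < c := mul_pos hp hσ
  set q : ℝ := 2 ^ |p - 2| with hq
  have hq0 : 0 < q := by positivity
  refine ⟨c * q * (2 * √(C / (c / q)) + 1), by positivity, 9 * C / (c / q), ?_⟩
  intro m hm hM r hr0 hr
  have hm0 : (0 : ℝ) < m := by positivity
  have hm1 : (1 : ℝ) ≤ m := by exact_mod_cast (by omega : 1 ≤ m)
  set P : ℝ := (m : ℝ) ^ (p - 2) with hP
  have hP0 : 0 < P := by positivity
  have hmP : (m : ℝ) ^ (p - 1) = m * P := by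
    rw [hP, show p - 1 = 1 + (p - 2) by ring, Real.rpow_add hm0, Real.rpow_one]
  let h : ℕ → ℝ := fun j => σ * (((m + j : ℕ) : ℝ) ^ p + ((m - j : ℕ) : ℝ) ^ p - 2 * (m : ℝ) ^ p)
  have hstep : ∀ j < m / 2, ∃ z : ℝ, P ≤ q * z ∧ z ≤ q * P ∧
      h (j + 1) - h j = c * z * (2 * j + 1) := by
    intro j hj
    have hjm : (2 * (j + 1) : ℝ) ≤ m := by exact_mod_cast (by omega : 2 * (j + 1) ≤ m)
    have hj0 : (0 : ℝ) ≤ j := by positivity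
    obtain ⟨z, hz, hz'⟩ := exists_rpow_second_difference (p := p) (a := m - (j + 1))
      (d := 2 * j + 1) (by linarith) (by linarith)
    have hz0 : 0 < z := by linarith [hz.1]
    refine ⟨z ^ (p - 2), ?_, ?_, ?_⟩
    · exact rpow_le_rpow_abs_mul_rpow _ hm0 hz0 two_pos (by linarith [hz.1]) (by linarith [hz.2])
    · exact rpow_le_rpow_abs_mul_rpow _ hz0 hm0 two_pos (by linarith [hz.2]) (by linarith [hz.1])
    · simp only [h]
      rw [Nat.cast_sub (by omega), Nat.cast_sub (by omega)]
      push_cast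
      rw [show (m : ℝ) - (j + 1) + 1 + (2 * j + 1) = m + (j + 1) by ring,
        show (m : ℝ) - (j + 1) + 1 = m - j by ring,
        show (m : ℝ) - (j + 1) + (2 * j + 1) = m + j by ring] at hz'
      rw [hc]
      linear_combination σ * hz'
  have hJ : (m : ℝ) ≤ 3 * (m / 2 : ℕ) := by exact_mod_cast (by omega : m ≤ 3 * (m / 2))
  have hA0 : 0 < c / q * P := by positivity
  obtain ⟨i, -, k, -, h1, h2, h3⟩ := exists_crossing (h := h) (A := c / q * P) (B := c * q * P)
    (r := r) (J := m / 2) (by simp [h]; right; ring) hA0 (by positivity)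
    (by
      intro j hj
      obtain ⟨z, hz, -, hz'⟩ := hstep j hj
      rw [hz']
      have hAz : c / q * P ≤ c * z := by
        rw [div_mul_eq_mul_div, div_le_iff₀ hq0]
        nlinarith
      gcongr)
    (by
      intro j hj
      obtain ⟨z, -, hz, hz'⟩ := hstep j hj
      rw [hz', mul_assoc c q P]
      gcongr)
    hr0
    (by
      rw [div_le_iff₀ (by positivity)] at hM
      have h9 : (m : ℝ) ^ 2 ≤ 9 * ((m / 2 : ℕ) : ℝ) ^ 2 := by nlinarith
      have h10 : 9 * C * m ≤ c / q * (9 * ((m / 2 : ℕ) : ℝ) ^ 2) := by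
        calc 9 * C * m ≤ (m * (c / q)) * m := by gcongr
          _ = c / q * (m : ℝ) ^ 2 := by ring
          _ ≤ _ := by gcongr
      rw [hmP] at hr
      nlinarith)
  refine ⟨m + i, m - i, m + k, m - k, h1, h2, h3.trans ?_⟩
  have hs : √(r / (c / q * P)) ≤ √(C / (c / q)) * √m := by
    rw [← Real.sqrt_mul (by positivity)]
    apply Real.sqrt_le_sqrt
    rw [div_le_iff₀ hA0]
    refine hr.trans_eq ?_
    rw [hmP]
    field_simp
  have hs1 : 1 ≤ √(m : ℝ) := Real.one_le_sqrt.mpr hm1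
  have hPs : (m : ℝ) ^ (p - 3 / 2) = P * √m := by
    rw [hP, Real.sqrt_eq_rpow, ← Real.rpow_add hm0]
    congr 1
    ring
  rw [hPs]
  calc c * q * P * (2 * √(r / (c / q * P)) + 1)
      ≤ c * q * P * (2 * (√(C / (c / q)) * √m) + √m) := by gcongr
    _ = _ := by ring

/-- Bounded targets are handled by a single `p`-th power. -/
theorem exists_rpow_sum_of_le {p e X : ℝ} (hp : 0 < p) (hX : 1 ≤ X) :
    ∃ D > 0, ∀ x : ℝ, 1 ≤ x → x ≤ X → ∃ u v : ℕ, x ≤ (u : ℝ) ^ p + (v : ℝ) ^ p ∧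
      (u : ℝ) ^ p + (v : ℝ) ^ p ≤ x + D * x ^ e := by
  have hX0 : 0 < X := by linarith
  refine ⟨2 ^ p * X * X ^ |e|, by positivity, fun x hx hxX => ?_⟩
  have hx0 : 0 < x := by linarith
  have hroot : (x ^ p⁻¹) ^ p = x := Real.rpow_inv_rpow hx0.le hp.ne'
  have hy : 1 ≤ x ^ p⁻¹ := Real.one_le_rpow hx (by positivity)
  refine ⟨⌈x ^ p⁻¹⌉₊, 0, ?_, ?_⟩
  · rw [Nat.cast_zero, Real.zero_rpow hp.ne', add_zero]
    conv_lhs => rw [← hroot]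
    exact Real.rpow_le_rpow (by positivity) (Nat.le_ceil _) hp.le
  · rw [Nat.cast_zero, Real.zero_rpow hp.ne', add_zero]
    have h1 : (⌈x ^ p⁻¹⌉₊ : ℝ) ^ p ≤ 2 ^ p * X := by
      calc (⌈x ^ p⁻¹⌉₊ : ℝ) ^ p ≤ (2 * x ^ p⁻¹) ^ p := by
            gcongr
            linarith [Nat.ceil_lt_add_one (show 0 ≤ x ^ p⁻¹ by linarith)]
        _ = 2 ^ p * x := by rw [Real.mul_rpow two_pos.le (by linarith), hroot]
        _ ≤ 2 ^ p * X := by gcongr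
    have h2 : 1 ≤ X ^ |e| * x ^ e := by
      simpa using rpow_le_rpow_abs_mul_rpow (a := 1) e one_pos hx0 hX0 (by nlinarith) (by linarith)
    have h3 : 2 ^ p * X * 1 ≤ 2 ^ p * X * (X ^ |e| * x ^ e) := by gcongr
    linarith

theorem exists_rpow_sum_of_ne_one {p : ℝ} (hp : 0 < p) (hp1 : p ≠ 1) :
    ∃ D : ℝ, 0 < D ∧ ∀ x : ℝ, 1 ≤ x →
      ∃ u v : ℕ, x ≤ (u : ℝ) ^ p + (v : ℝ) ^ p ∧
        (u : ℝ) ^ p + (v : ℝ) ^ p ≤ x + D * x ^ (1 - 3 / (2 * p)) := by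
  obtain ⟨σ, hσ1, hσ⟩ : ∃ σ : ℝ, (σ = 1 ∨ σ = -1) ∧ 0 < σ * (p - 1) := by
    rcases lt_or_gt_of_ne hp1 with h | h
    · exact ⟨-1, Or.inr rfl, by linarith⟩
    · exact ⟨1, Or.inl rfl, by linarith⟩
  set C : ℝ := 2 * (p * 2 ^ |p - 1| * 2 ^ |p - 1|) with hC
  have hC0 : 0 < C := by positivity
  obtain ⟨K, hK, M, hKM⟩ := exists_near_diagonal hp hσ hC0
  set Y : ℝ := max M 0 + 3 with hY
  have hYM : M + 3 ≤ Y := by rw [hY]; gcongr; exact le_max_left _ _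
  have hY3 : 3 ≤ Y := by rw [hY]; linarith [le_max_right M 0]
  obtain ⟨D, hD, hDX⟩ := exists_rpow_sum_of_le (e := 1 - 3 / (2 * p)) (X := 2 * Y ^ p) hp
    (by linarith [Real.one_le_rpow (show 1 ≤ Y by linarith) hp.le])
  set L : ℝ := 2 * 2 ^ p⁻¹ with hL
  have h2p : 1 ≤ (2 : ℝ) ^ p⁻¹ := Real.one_le_rpow one_le_two (by positivity)
  have hLpos : 0 < L ^ |p - 3 / 2| := by positivity
  refine ⟨max D (K * L ^ |p - 3 / 2|), lt_max_of_lt_left hD, fun x hx => ?_⟩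
  have hx0 : 0 < x := by linarith
  have hxe : 0 < x ^ (1 - 3 / (2 * p)) := by positivity
  rcases le_total x (2 * Y ^ p) with hxY | hxY
  · obtain ⟨u, v, h1, h2⟩ := hDX x hx hxY
    refine ⟨u, v, h1, h2.trans ?_⟩
    gcongr
    exact le_max_left _ _
  set y : ℝ := (x / 2) ^ p⁻¹ with hy
  have hyp : 2 * y ^ p = x := by
    rw [hy, Real.rpow_inv_rpow (by positivity) hp.ne']; ring
  have hyY : Y ≤ y := by
    rw [hy, Real.le_rpow_inv_iff_of_pos (by linarith) (by positivity) hp]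
    linarith
  have hy0 : 0 < y := by linarith
  have hyx : x ^ p⁻¹ = 2 ^ p⁻¹ * y := by
    rw [hy, ← Real.mul_rpow (by positivity) (by positivity)]
    congr 1
    ring
  -- The diagonal point on the correct side of the target.
  obtain ⟨m, hmy, hym, hr0, hr⟩ : ∃ m : ℕ, y - 1 ≤ m ∧ (m : ℝ) ≤ y + 1 ∧
      0 ≤ σ * (x - 2 * (m : ℝ) ^ p) ∧
      σ * (x - 2 * (m : ℝ) ^ p) ≤ C * (m : ℝ) ^ (p - 1) := by
    rcases hσ1 with rfl | rfl
    · have hf := Nat.floor_le hy0.le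
      have hf' := Nat.lt_floor_add_one y
      have hm1 : (1 : ℝ) ≤ ⌊y⌋₊ := by linarith
      refine ⟨⌊y⌋₊, by linarith, by linarith, ?_, ?_⟩
      · have : (⌊y⌋₊ : ℝ) ^ p ≤ y ^ p := by gcongr
        linarith
      · have h1 : y ^ p ≤ ((⌊y⌋₊ : ℝ) + 1) ^ p := by gcongr
        have h2 := add_one_rpow_sub_rpow_le hp hm1
        have h3 : 1 ≤ (2 : ℝ) ^ |p - 1| := Real.one_le_rpow one_le_two (abs_nonneg _)
        have h4 : 0 ≤ p * 2 ^ |p - 1| * (⌊y⌋₊ : ℝ) ^ (p - 1) := by positivity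
        rw [hC]
        nlinarith
    · have hf := Nat.le_ceil y
      have hf' := Nat.ceil_lt_add_one hy0.le
      refine ⟨⌈y⌉₊, by linarith, by linarith, ?_, ?_⟩
      · have : y ^ p ≤ (⌈y⌉₊ : ℝ) ^ p := by gcongr
        linarith
      · have h1 : ((⌈y⌉₊ : ℝ) - 1) ^ p ≤ y ^ p :=
          Real.rpow_le_rpow (by linarith) (by linarith) hp.le
        have h2 := add_one_rpow_sub_rpow_le (m := (⌈y⌉₊ : ℝ) - 1) hp (by linarith)
        rw [sub_add_cancel] at h2
        have h3 : ((⌈y⌉₊ : ℝ) - 1) ^ (p - 1) ≤ 2 ^ |p - 1| * (⌈y⌉₊ : ℝ) ^ (p - 1) :=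
          rpow_le_rpow_abs_mul_rpow _ (by linarith) (by linarith) two_pos (by linarith)
            (by linarith)
        have h4 : p * 2 ^ |p - 1| * ((⌈y⌉₊ : ℝ) - 1) ^ (p - 1) ≤
            p * 2 ^ |p - 1| * (2 ^ |p - 1| * (⌈y⌉₊ : ℝ) ^ (p - 1)) := by gcongr
        rw [hC]
        linarith
  have hm2 : 2 ≤ m := by exact_mod_cast (by linarith : (2 : ℝ) ≤ m)
  obtain ⟨u, v, u', v', h1, h2, h3⟩ := hKM m hm2 (by linarith) _ hr0 hr
  have hmain : K * (m : ℝ) ^ (p - 3 / 2) ≤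
      max D (K * L ^ |p - 3 / 2|) * x ^ (1 - 3 / (2 * p)) := by
    have hxp : x ^ (1 - 3 / (2 * p)) = (x ^ p⁻¹) ^ (p - 3 / 2) := by
      rw [← Real.rpow_mul hx0.le]
      congr 1
      field_simp
    have hmx : (m : ℝ) ^ (p - 3 / 2) ≤ L ^ |p - 3 / 2| * (x ^ p⁻¹) ^ (p - 3 / 2) := by
      apply rpow_le_rpow_abs_mul_rpow _ (by linarith) (by positivity) (by positivity)
      · rw [hyx, hL]
        have : y ≤ 2 ^ p⁻¹ * (2 ^ p⁻¹ * y) := by nlinarith [mul_le_mul h2p h2p one_pos.le (by linarith)]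
        linarith
      · rw [hyx, hL]
        have : (2 : ℝ) ^ p⁻¹ * y ≤ 2 ^ p⁻¹ * (2 * m) := by gcongr; linarith
        linarith
    calc K * (m : ℝ) ^ (p - 3 / 2) ≤ K * (L ^ |p - 3 / 2| * (x ^ p⁻¹) ^ (p - 3 / 2)) := by gcongr
      _ = K * L ^ |p - 3 / 2| * x ^ (1 - 3 / (2 * p)) := by rw [hxp]; ring
      _ ≤ _ := by gcongr; exact le_max_right _ _
  rcases hσ1 with rfl | rfl
  · exact ⟨u', v', by linarith, by linarith⟩
  · exact ⟨u, v, by linarith, by linarith⟩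

theorem add_one_rpow_sub_rpow_le_of_one_le {p a : ℝ} (hp : 1 ≤ p) (ha : 0 ≤ a) :
    (a + 1) ^ p - a ^ p ≤ p * (a + 1) ^ (p - 1) := by
  obtain ⟨z, hz, h⟩ := exists_add_rpow_sub_rpow (p := p) ha one_pos (Or.inr (by linarith))
  rw [h, mul_one]
  have := hz.1
  gcongr
  · linarith
  · exact hz.2.le

theorem exists_rpow_sum_greedy {p : ℝ} (hp : 1 ≤ p) :
    ∃ D : ℝ, 0 < D ∧ ∀ x : ℝ, 1 ≤ x →
      ∃ u v : ℕ, x ≤ (u : ℝ) ^ p + (v : ℝ) ^ p ∧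
        (u : ℝ) ^ p + (v : ℝ) ^ p ≤ x + D * x ^ (1 - 2 / p + 1 / p ^ 2) := by
  have hp0 : 0 < p := by linarith
  set C : ℝ := p * 2 ^ (p - 1) with hC
  have hC0 : 0 < C := by positivity
  refine ⟨p * (C ^ p⁻¹ + 1) ^ (p - 1), by positivity, fun x hx => ?_⟩
  have hx0 : 0 < x := by linarith
  set y : ℝ := x ^ p⁻¹ with hy
  have hyp : y ^ p = x := Real.rpow_inv_rpow hx0.le hp0.ne'
  have hy1 : 1 ≤ y := Real.one_le_rpow hx (by positivity)
  have hf := Nat.floor_le (show 0 ≤ y by linarith)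
  have hf' := Nat.lt_floor_add_one y
  set r : ℝ := x - (⌊y⌋₊ : ℝ) ^ p with hr
  have hr0 : 0 ≤ r := by
    have : (⌊y⌋₊ : ℝ) ^ p ≤ y ^ p := by gcongr
    linarith
  have hrC : r ≤ C * y ^ (p - 1) := by
    have h1 : y ^ p ≤ ((⌊y⌋₊ : ℝ) + 1) ^ p := by gcongr
    have h2 := add_one_rpow_sub_rpow_le_of_one_le hp (Nat.cast_nonneg ⌊y⌋₊)
    have h3 : p * ((⌊y⌋₊ : ℝ) + 1) ^ (p - 1) ≤ p * (2 * y) ^ (p - 1) := by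
      gcongr
      linarith
    rw [Real.mul_rpow two_pos.le (by linarith)] at h3
    rw [hC]
    linarith
  set R : ℝ := r ^ p⁻¹ with hR
  have hR0 : 0 ≤ R := by positivity
  have hRp : R ^ p = r := Real.rpow_inv_rpow hr0 hp0.ne'
  have hRC : R + 1 ≤ (C ^ p⁻¹ + 1) * x ^ ((p - 1) * p⁻¹ * p⁻¹) := by
    have h1 : R ≤ (C * y ^ (p - 1)) ^ p⁻¹ := Real.rpow_le_rpow hr0 hrC (by positivity)
    rw [Real.mul_rpow hC0.le (by positivity), hy, ← Real.rpow_mul hx0.le,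
      ← Real.rpow_mul hx0.le, mul_comm p⁻¹] at h1
    have h2 : 1 ≤ x ^ ((p - 1) * p⁻¹ * p⁻¹) :=
      Real.one_le_rpow hx (mul_nonneg (mul_nonneg (by linarith) (by positivity)) (by positivity))
    linarith
  refine ⟨⌊y⌋₊, ⌈R⌉₊, ?_, ?_⟩
  · have : R ^ p ≤ (⌈R⌉₊ : ℝ) ^ p := by
      gcongr
      exact Nat.le_ceil R
    linarith
  · have h1 : (⌈R⌉₊ : ℝ) ^ p ≤ (R + 1) ^ p := by
      gcongr
      exact (Nat.ceil_lt_add_one hR0).le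
    have h2 := add_one_rpow_sub_rpow_le_of_one_le hp hR0
    have h3 : p * (R + 1) ^ (p - 1) ≤
        p * ((C ^ p⁻¹ + 1) * x ^ ((p - 1) * p⁻¹ * p⁻¹)) ^ (p - 1) := by
      gcongr
    rw [Real.mul_rpow (by positivity) (by positivity), ← Real.rpow_mul hx0.le,
      show (p - 1) * p⁻¹ * p⁻¹ * (p - 1) = 1 - 2 / p + 1 / p ^ 2 by field_simp; ring] at h3
    linarith

theorem stmt_4 (θ : ℝ) (hθ : 0 < θ) :
    ∃ D : ℝ, 0 < D ∧ ∀ x : ℝ, 1 ≤ x →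
      ∃ u v : ℕ, x ≤ (u : ℝ) ^ θ + (v : ℝ) ^ θ ∧
        (u : ℝ) ^ θ + (v : ℝ) ^ θ ≤ x + D * x ^ Psi θ := by
  unfold Psi
  split_ifs with h1 h2 h3
  · exact exists_rpow_sum_of_ne_one hθ h1.ne
  · subst h2
    refine ⟨1, one_pos, fun x hx => ⟨⌈x⌉₊, 0, ?_, ?_⟩⟩
    · simpa using Nat.le_ceil x
    · simpa using (Nat.ceil_lt_add_one (by linarith : 0 ≤ x)).le
  · exact exists_rpow_sum_of_ne_one hθ h2
  · exact exists_rpow_sum_greedy (by linarith)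
end

section
/- Let d ≥ 2 and ξ ≥ 1 be integers and let P_ξ^* be the set of integers of the form ∏_{j=1}^ξ p_j^{a_j} with each a_j ∈ {0, 1, …, d−1}, excluding 1, where p_j is the j-th prime. There exists a constant A > 0 (depending only on d and ξ) such that for every function c : P_ξ^* → ℤ that is not identically zero, writing n = max_{f ∈ P_ξ^*} |c_f| ≥ 1, one has ‖ Σ_{f ∈ P_ξ^*} c_f · f^{1/d} ‖ ≥ A · n^{−d^ξ + 1}. -/
/-- `PstarSet d ξ` : the set of integers ∏_{j=1}^ξ p_j^{a_j} with a_j ∈ {0,…,d−1},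
excluding 1, where p_j is the j-th prime. -/
noncomputable def PstarSet (d ξ : ℕ) : Finset ℕ :=
  (Finset.image
    (fun a : Fin ξ → Fin d => ∏ j : Fin ξ, (Nat.nth Nat.Prime (j : ℕ)) ^ ((a j : ℕ)))
    Finset.univ).erase 1

open Polynomial in
/-- A positive irrational real radical has trace zero in every number field containing it. -/
theorem trace_eq_zero_of_pow_eq_rat (K : IntermediateField ℚ ℝ) [FiniteDimensional ℚ K] (x : K)
    (hx : 0 < (x : ℝ)) {d : ℕ} (hd : d ≠ 0) (q : ℚ) (hq : (x : ℝ) ^ d = q)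
    (hirr : ∀ r : ℚ, (x : ℝ) ≠ r) : Algebra.trace ℚ K x = 0 := by
  have hint : IsIntegral ℚ x := Algebra.IsIntegral.isIntegral x
  have hmonic := minpoly.monic hint
  have hdvd : minpoly ℚ x ∣ X ^ d - C q := by
    apply minpoly.dvd
    apply Subtype.ext
    simp [hq]
  have hroot : ∀ z ∈ ((minpoly ℚ x).map (algebraMap ℚ ℂ)).roots, ‖z‖ = (x : ℝ) := by
    intro z hz
    have h0 : aeval z (minpoly ℚ x) = 0 := by
      rw [← eval_map_algebraMap]
      exact isRoot_of_mem_roots hz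
    have h1 : aeval z (X ^ d - C q) = 0 := aeval_eq_zero_of_dvd_aeval_eq_zero hdvd h0
    have h2 : z ^ d = (((x : ℝ) ^ d : ℝ) : ℂ) := by
      rw [hq]
      simpa [sub_eq_zero] using h1
    have h3 : ‖z‖ ^ d = (x : ℝ) ^ d := by
      rw [← norm_pow, h2, Complex.norm_real, Real.norm_of_nonneg (by positivity)]
    exact (pow_left_inj₀ (norm_nonneg z) hx.le hd).1 h3
  set j := (minpoly ℚ x).natDegree with hj
  have hcoeff : ((|(minpoly ℚ x).coeff 0| : ℚ) : ℝ) = (x : ℝ) ^ j := by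
    have hs := IsAlgClosed.splits ((minpoly ℚ x).map (algebraMap ℚ ℂ))
    have h := congrArg norm (hs.coeff_zero_eq_prod_roots_of_monic (hmonic.map _))
    have hcard := hs.natDegree_eq_card_roots
    have hprod : ‖((minpoly ℚ x).map (algebraMap ℚ ℂ)).roots.prod‖ = (x : ℝ) ^ j := by
      have hmap := map_multiset_prod (normHom : ℂ →*₀ ℝ)
        ((minpoly ℚ x).map (algebraMap ℚ ℂ)).roots
      rw [Multiset.map_congr (f := normHom) (g := fun _ => (x : ℝ)) rfl hroot, Multiset.map_const', Multiset.prod_replicate, ← hcard,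
        natDegree_map] at hmap
      exact hmap
    rw [norm_mul, norm_pow, norm_neg, norm_one, one_pow, one_mul, hprod, coeff_map] at h
    rw [← h]
    simp
  have hj0 : 0 < j := minpoly.natDegree_pos hint
  have hmin : minpoly ℚ x = X ^ j - C |(minpoly ℚ x).coeff 0| := by
    symm
    apply eq_of_monic_of_dvd_of_natDegree_le hmonic (monic_X_pow_sub_C _ hj0.ne')
    · apply minpoly.dvd
      rw [map_sub, map_pow, aeval_X, aeval_C, sub_eq_zero]
      exact Subtype.ext (hcoeff.symm.trans (eq_ratCast (algebraMap ℚ ℝ) _).symm)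
    · rw [natDegree_X_pow_sub_C]
  have hj1 : j ≠ 1 := by
    intro h
    rw [h, pow_one] at hcoeff
    exact hirr _ hcoeff.symm
  have hnext : (minpoly ℚ x).nextCoeff = 0 := by
    rw [nextCoeff_of_natDegree_pos hj0, hmin, coeff_sub, coeff_X_pow, coeff_C,
      natDegree_X_pow_sub_C, if_neg (by omega), if_neg (by omega), sub_zero]
  rw [trace_eq_finrank_mul_minpoly_nextCoeff, hnext, neg_zero, mul_zero]

/-- Positive real radicals with pairwise irrational quotients are linearly independent. -/
theorem radicals_linearIndependent (K : IntermediateField ℚ ℝ) [FiniteDimensional ℚ K]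
    {ι : Type*} (s : Finset ι) (b : ι → K) {d : ℕ} (hd : d ≠ 0)
    (hpos : ∀ i ∈ s, 0 < (b i : ℝ)) (q : ι → ℚ) (hq : ∀ i ∈ s, (b i : ℝ) ^ d = q i)
    (hirr : ∀ i ∈ s, ∀ j ∈ s, i ≠ j → ∀ r : ℚ, (b i : ℝ) / b j ≠ r)
    (c : ι → ℚ) (hsum : ∑ i ∈ s, c i • b i = 0) : ∀ i ∈ s, c i = 0 := by
  classical
  intro j hj
  have hbj : b j ≠ 0 := fun h => (hpos j hj).ne' (by simp [h])
  have h1 : ∑ i ∈ s, c i • (b i / b j) = 0 := by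
    have := congrArg (· / b j) hsum
    simpa [Finset.sum_div, smul_div_assoc] using this
  have h2 := congrArg (Algebra.trace ℚ K) h1
  rw [map_sum, map_zero, Finset.sum_eq_single_of_mem j hj, div_self hbj, map_smul,
    ← map_one (algebraMap ℚ K), Algebra.trace_algebraMap] at h2
  · have hfin : Module.finrank ℚ K ≠ 0 := Module.finrank_pos.ne'
    simpa [hfin] using h2
  · intro i hi hij
    rw [map_smul, trace_eq_zero_of_pow_eq_rat K (b i / b j) _ hd (q i / q j), smul_zero]
    · simp [div_pow, hq i hi, hq j hj]
    · simpa using hirr i hi j hj hij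
    · simpa using div_pos (hpos i hi) (hpos j hj)

/-- A Liouville-type lower bound: a nonzero algebraic integer all of whose conjugates are at most
`B` cannot be too small. -/
theorem one_le_abs_mul_pow (K : IntermediateField ℚ ℝ) [FiniteDimensional ℚ K] (x : K)
    (hint : IsIntegral ℤ x) (hx : x ≠ 0) (B : ℝ) (hB : ∀ σ : K →ₐ[ℚ] ℂ, ‖σ x‖ ≤ B) :
    1 ≤ |(x : ℝ)| * B ^ (Module.finrank ℚ K - 1) := by
  classical
  obtain ⟨y, hy⟩ := IsIntegrallyClosed.isIntegral_iff.1 (Algebra.isIntegral_norm ℚ hint)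
  have hy0 : y ≠ 0 := by
    rintro rfl
    exact hx (Algebra.norm_eq_zero_iff.1 (hy.symm.trans (map_zero _)))
  let σ₀ : K →ₐ[ℚ] ℂ := (Complex.ofRealAm.restrictScalars ℚ).comp K.val
  have hσ₀ : ‖σ₀ x‖ = |(x : ℝ)| := by
    have : σ₀ x = ((x : ℝ) : ℂ) := rfl
    rw [this, Complex.norm_real, Real.norm_eq_abs]
  have hprod := congrArg norm (Algebra.norm_eq_prod_embeddings ℚ ℂ x)
  rw [norm_prod, ← Finset.mul_prod_erase _ _ (Finset.mem_univ σ₀), hσ₀, ← hy] at hprod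
  have hle : ∏ σ ∈ Finset.univ.erase σ₀, ‖σ x‖ ≤ B ^ (Module.finrank ℚ K - 1) := by
    rw [← AlgHom.card ℚ K ℂ, ← Finset.card_univ,
      ← Finset.card_erase_of_mem (Finset.mem_univ σ₀), ← Finset.prod_const]
    exact Finset.prod_le_prod (fun _ _ => norm_nonneg _) fun σ _ => hB σ
  calc (1 : ℝ) ≤ |(y : ℝ)| := by exact_mod_cast Int.one_le_abs hy0
    _ = |(x : ℝ)| * ∏ σ ∈ Finset.univ.erase σ₀, ‖σ x‖ := by rw [← hprod]; simp
    _ ≤ _ := by gcongr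

open Polynomial in
/-- Adjoining `k` many `d`-th roots of rationals gives a number field of degree at most `d ^ k`. -/
theorem finrank_adjoin_radicals_le {d : ℕ} (hd : d ≠ 0) (s : Finset ℝ)
    (hs : ∀ x ∈ s, ∃ q : ℚ, x ^ d = q) :
    FiniteDimensional ℚ (IntermediateField.adjoin ℚ (s : Set ℝ)) ∧
      Module.finrank ℚ (IntermediateField.adjoin ℚ (s : Set ℝ)) ≤ d ^ s.card := by
  classical
  induction s using Finset.induction_on with
  | empty =>
    rw [Finset.coe_empty, IntermediateField.adjoin_empty]
    exact ⟨inferInstance, by simp⟩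
  | insert a s ha ih =>
    obtain ⟨_, hr⟩ := ih fun x hx => hs x (Finset.mem_insert_of_mem hx)
    obtain ⟨q, hq⟩ := hs a (Finset.mem_insert_self _ _)
    have hev : aeval a (X ^ d - C q) = 0 := by simp [hq]
    have hint : IsIntegral ℚ a := ⟨X ^ d - C q, monic_X_pow_sub_C q hd, hev⟩
    have := IntermediateField.adjoin.finiteDimensional hint
    have hdeg : Module.finrank ℚ (IntermediateField.adjoin ℚ {a}) ≤ d := by
      rw [IntermediateField.adjoin.finrank hint, ← natDegree_X_pow_sub_C (n := d) (r := q)]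
      exact natDegree_le_of_dvd (minpoly.dvd _ _ hev) (monic_X_pow_sub_C q hd).ne_zero
    rw [Finset.coe_insert, Set.insert_eq, IntermediateField.adjoin_union]
    refine ⟨inferInstance, (IntermediateField.finrank_sup_le _ _).trans ?_⟩
    rw [Finset.card_insert_of_notMem ha, pow_succ']
    exact Nat.mul_le_mul hdeg hr

theorem factorization_prod_nth_prime_lt {d ξ : ℕ} (hd : d ≠ 0) (a : Fin ξ → Fin d) (p : ℕ) :
    (∏ j : Fin ξ, (Nat.nth Nat.Prime (j : ℕ)) ^ ((a j : ℕ))).factorization p < d := by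
  classical
  have hinj := Nat.nth_injective Nat.infinite_setOfPred_prime
  have hp (j : ℕ) : (Nat.nth Nat.Prime j).Prime := Nat.prime_nth_prime j
  rw [Nat.factorization_prod_apply (g := fun j : Fin ξ => Nat.nth Nat.Prime j ^ (a j : ℕ))
    fun j _ => pow_ne_zero _ (hp j).ne_zero]
  by_cases h : ∃ j : Fin ξ, Nat.nth Nat.Prime j = p
  · obtain ⟨j, rfl⟩ := h
    rw [Finset.sum_eq_single_of_mem j (Finset.mem_univ j)]
    · simp
    · intro i _ hij
      have : Nat.nth Nat.Prime i ≠ Nat.nth Nat.Prime j := fun h => hij (Fin.ext (hinj h))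
      simp [this]
  · push Not at h
    rw [Finset.sum_eq_zero]
    · exact hd.pos
    · intro i _
      simp [h i]

theorem eq_of_mul_pow_eq_mul_pow {d f g a b : ℕ} (hf : f ≠ 0) (hg : g ≠ 0) (ha : a ≠ 0)
    (hb : b ≠ 0) (hfd : ∀ p, f.factorization p < d) (hgd : ∀ p, g.factorization p < d)
    (h : f * b ^ d = g * a ^ d) : f = g := by
  apply Nat.eq_of_factorization_eq hf hg
  intro p
  have h1 := congrArg (fun n => n.factorization p % d) h
  simpa [Nat.factorization_mul, hf, hg, ha, hb, Nat.add_mul_mod_self_left,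
    Nat.mod_eq_of_lt (hfd p), Nat.mod_eq_of_lt (hgd p)] using h1

/-- Quotients of `d`-th roots of distinct `d`-th power free integers are irrational. -/
theorem rpow_inv_div_ne_rat {d f g : ℕ} (hd : d ≠ 0) (hf : f ≠ 0) (hg : g ≠ 0)
    (hfd : ∀ p, f.factorization p < d) (hgd : ∀ p, g.factorization p < d) (hfg : f ≠ g) (r : ℚ) :
    (f : ℝ) ^ ((d : ℝ)⁻¹) / (g : ℝ) ^ ((d : ℝ)⁻¹) ≠ r := by
  intro h
  have hr : 0 < r := by
    have : (0 : ℝ) < r := by rw [← h]; positivity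
    exact_mod_cast this
  have h1 : (f : ℝ) / g = (r : ℝ) ^ d := by
    rw [← h, div_pow, Real.rpow_inv_natCast_pow (by positivity) hd,
      Real.rpow_inv_natCast_pow (by positivity) hd]
  have h2 : (f : ℚ) / g = r ^ d := by
    apply Rat.cast_injective (α := ℝ)
    simpa using h1
  have hnum : ((r.num.natAbs : ℕ) : ℚ) = r.num := by
    rw [← Int.cast_natCast, Int.natAbs_of_nonneg (Rat.num_pos.2 hr).le]
  apply hfg
  apply eq_of_mul_pow_eq_mul_pow hf hg (a := r.num.natAbs) (b := r.den) _ r.den_nz hfd hgd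
  · have hden : (r.den : ℚ) ≠ 0 := by exact_mod_cast r.den_nz
    have hg' : (g : ℚ) ≠ 0 := by exact_mod_cast hg
    rw [← Rat.num_div_den r, div_pow, div_eq_div_iff hg' (by positivity), ← hnum] at h2
    rw [mul_comm g]
    exact_mod_cast h2
  · exact Int.natAbs_ne_zero.2 (Rat.num_pos.2 hr).ne'

theorem ne_zero_and_factorization_lt_of_mem {d ξ : ℕ} (hd : d ≠ 0) {f : ℕ}
    (hf : f ∈ insert 1 (PstarSet d ξ)) : f ≠ 0 ∧ ∀ p, f.factorization p < d := by
  rcases Finset.mem_insert.1 hf with rfl | hf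
  · exact ⟨one_ne_zero, fun p => by simpa using hd.pos⟩
  · obtain ⟨a, -, rfl⟩ := Finset.mem_image.1 (Finset.mem_of_mem_erase hf)
    exact ⟨Finset.prod_ne_zero_iff.2 fun j _ => pow_ne_zero _ (Nat.prime_nth_prime _).ne_zero,
      factorization_prod_nth_prime_lt hd a⟩

theorem rpow_inv_mem_of_mem {d ξ : ℕ} (K : IntermediateField ℚ ℝ)
    (hK : ∀ j : Fin ξ, ((Nat.nth Nat.Prime j : ℕ) : ℝ) ^ ((d : ℝ)⁻¹) ∈ K) {f : ℕ}
    (hf : f ∈ insert 1 (PstarSet d ξ)) : (f : ℝ) ^ ((d : ℝ)⁻¹) ∈ K := by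
  rcases Finset.mem_insert.1 hf with rfl | hf
  · simp
  · obtain ⟨a, -, rfl⟩ := Finset.mem_image.1 (Finset.mem_of_mem_erase hf)
    push_cast
    rw [← Real.finsetProd_rpow _ _ fun j _ => by positivity]
    refine prod_mem fun j _ => ?_
    rw [← Real.rpow_natCast, ← Real.rpow_mul (by positivity), mul_comm, Real.rpow_mul (by positivity),
      Real.rpow_natCast]
    exact pow_mem (hK j) _

theorem stmt_11 (d ξ : ℕ) (hd : 2 ≤ d) (hξ : 1 ≤ ξ) :
    ∃ A : ℝ, 0 < A ∧ ∀ c : ℕ → ℤ, (∃ f ∈ PstarSet d ξ, c f ≠ 0) →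
      distNearestInt (∑ f ∈ PstarSet d ξ, (c f : ℝ) * (f : ℝ) ^ ((d : ℝ)⁻¹)) ≥
        A * (((PstarSet d ξ).sup fun f => (c f).natAbs : ℕ) : ℝ) ^
          (-(d : ℝ) ^ ξ + 1) := by
  classical
  have hd0 : d ≠ 0 := by omega
  set S : Finset ℝ :=
    Finset.univ.image fun j : Fin ξ => ((Nat.nth Nat.Prime j : ℕ) : ℝ) ^ ((d : ℝ)⁻¹) with hS
  obtain ⟨_, hrank⟩ := finrank_adjoin_radicals_le hd0 S (by
    intro x hx
    obtain ⟨j, -, rfl⟩ := Finset.mem_image.1 hx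
    exact ⟨(Nat.nth Nat.Prime j : ℕ), by
      rw [Real.rpow_inv_natCast_pow (by positivity) hd0, Rat.cast_natCast]⟩)
  set K := IntermediateField.adjoin ℚ (S : Set ℝ) with hK
  have hrank' : Module.finrank ℚ K ≤ d ^ ξ := hrank.trans
    (Nat.pow_le_pow_right hd0.pos (Finset.card_image_le.trans (by simp)))
  have hmem {f : ℕ} (hf : f ∈ insert 1 (PstarSet d ξ)) : (f : ℝ) ^ ((d : ℝ)⁻¹) ∈ K :=
    rpow_inv_mem_of_mem K (fun j => IntermediateField.subset_adjoin _ _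
      (Finset.mem_coe.2 (Finset.mem_image_of_mem _ (Finset.mem_univ j)))) hf
  let b : ℕ → K := fun f => if h : (f : ℝ) ^ ((d : ℝ)⁻¹) ∈ K then ⟨_, h⟩ else 0
  have hb {f : ℕ} (hf : f ∈ insert 1 (PstarSet d ξ)) : (b f : ℝ) = (f : ℝ) ^ ((d : ℝ)⁻¹) := by
    simp [b, hmem hf]
  have hb1 : b 1 = 1 := Subtype.ext (by rw [hb (Finset.mem_insert_self _ _)]; simp)
  have hbpow {f : ℕ} (hf : f ∈ insert 1 (PstarSet d ξ)) : b f ^ d = (f : K) :=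
    Subtype.ext (by simp [hb hf, Real.rpow_inv_natCast_pow (Nat.cast_nonneg f) hd0])
  have hbint {f : ℕ} (hf : f ∈ insert 1 (PstarSet d ξ)) : IsIntegral ℤ (b f) := by
    refine IsIntegral.of_pow hd0.pos ?_
    rw [hbpow hf]
    exact isIntegral_natCast f
  have hbnorm {f : ℕ} (hf : f ∈ insert 1 (PstarSet d ξ)) (σ : K →ₐ[ℚ] ℂ) :
      ‖σ (b f)‖ = (f : ℝ) ^ ((d : ℝ)⁻¹) := by
    refine (pow_left_inj₀ (norm_nonneg _) (by positivity) hd0).1 ?_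
    rw [← norm_pow, ← map_pow, hbpow hf, map_natCast, Complex.norm_natCast,
      Real.rpow_inv_natCast_pow (by positivity) hd0]
  have h1 : 1 ∉ PstarSet d ξ := by simp [PstarSet]
  set T : ℝ := ∑ f ∈ PstarSet d ξ, (f : ℝ) ^ ((d : ℝ)⁻¹) with hT
  have hT0 : 0 ≤ T := Finset.sum_nonneg fun f _ => by positivity
  refine ⟨((1 + 2 * T) ^ (d ^ ξ - 1))⁻¹, by positivity, ?_⟩
  rintro c ⟨f₀, hf₀, hc⟩
  set n : ℕ := (PstarSet d ξ).sup fun f => (c f).natAbs with hn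
  have hle {f : ℕ} (hf : f ∈ PstarSet d ξ) : |(c f : ℝ)| ≤ n := by
    have : (c f).natAbs ≤ n := Finset.le_sup (f := fun f => (c f).natAbs) hf
    rw [← Int.cast_abs, Int.abs_eq_natAbs]
    exact_mod_cast this
  have hn1 : (1 : ℝ) ≤ n := le_trans (by exact_mod_cast Int.one_le_abs hc) (hle hf₀)
  set s : ℝ := ∑ f ∈ PstarSet d ξ, (c f : ℝ) * (f : ℝ) ^ ((d : ℝ)⁻¹) with hs
  have hsum : ∑ f ∈ PstarSet d ξ, |(c f : ℝ)| * (f : ℝ) ^ ((d : ℝ)⁻¹) ≤ n * T := by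
    rw [hT, Finset.mul_sum]
    exact Finset.sum_le_sum fun f hf => mul_le_mul_of_nonneg_right (hle hf) (by positivity)
  have hsabs : |s| ≤ n * T := by
    refine ((Finset.abs_sum_le_sum_abs _ _).trans_eq ?_).trans hsum
    refine Finset.sum_congr rfl fun f _ => ?_
    rw [abs_mul, abs_of_nonneg (by positivity : 0 ≤ (f : ℝ) ^ ((d : ℝ)⁻¹))]
  set m : ℤ := round s with hm
  have hmabs : |(m : ℝ)| ≤ 1 + n * T := by
    have h2 := abs_sub_round s
    have h3 := abs_sub_abs_le_abs_sub (m : ℝ) s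
    rw [abs_sub_comm] at h3
    linarith
  set x : K := ∑ f ∈ PstarSet d ξ, (c f : K) * b f - (m : K) with hx
  have hxs : (x : ℝ) = s - m := by
    rw [hx, hs, AddSubgroupClass.coe_sub, SubringClass.coe_intCast, AddSubmonoidClass.coe_finsetSum]
    congr 1
    refine Finset.sum_congr rfl fun f hf => ?_
    rw [MulMemClass.coe_mul, SubringClass.coe_intCast, hb (Finset.mem_insert_of_mem hf)]
  have hxint : IsIntegral ℤ x := by
    refine IsIntegral.sub (IsIntegral.sum _ fun f hf => ?_) (isIntegral_intCast _)
    exact (isIntegral_intCast _).mul (hbint (Finset.mem_insert_of_mem hf))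
  have hx0 : x ≠ 0 := by
    intro h0
    have hind := radicals_linearIndependent K (insert 1 (PstarSet d ξ)) b hd0
      (fun f hf => by
        have := (ne_zero_and_factorization_lt_of_mem hd0 hf).1
        rw [hb hf]
        positivity)
      (fun f => f) (fun f hf => by
        rw [hb hf, Real.rpow_inv_natCast_pow (by positivity) hd0, Rat.cast_natCast])
      (fun f hf g hg hfg => by
        obtain ⟨hf0, hfd⟩ := ne_zero_and_factorization_lt_of_mem hd0 hf
        obtain ⟨hg0, hgd⟩ := ne_zero_and_factorization_lt_of_mem hd0 hg
        rw [hb hf, hb hg]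
        exact rpow_inv_div_ne_rat hd0 hf0 hg0 hfd hgd hfg)
      (fun f => if f = 1 then -m else c f) (by
        rw [Finset.sum_insert h1, if_pos rfl, hb1, ← h0, hx, sub_eq_neg_add]
        congr 1
        · simp [Algebra.smul_def]
        · refine Finset.sum_congr rfl fun f hf => ?_
          rw [if_neg (ne_of_mem_of_not_mem hf h1)]
          simp [Algebra.smul_def])
      f₀ (Finset.mem_insert_of_mem hf₀)
    rw [if_neg (ne_of_mem_of_not_mem hf₀ h1)] at hind
    exact hc (by exact_mod_cast hind)
  have hconj (σ : K →ₐ[ℚ] ℂ) : ‖σ x‖ ≤ n * (1 + 2 * T) := by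
    have h2 : ‖σ x‖ ≤ (∑ f ∈ PstarSet d ξ, |(c f : ℝ)| * (f : ℝ) ^ ((d : ℝ)⁻¹)) + |(m : ℝ)| := by
      rw [hx, map_sub, map_sum, map_intCast]
      refine (norm_sub_le _ _).trans (add_le_add ((norm_sum_le _ _).trans_eq ?_) ?_)
      · refine Finset.sum_congr rfl fun f hf => ?_
        rw [map_mul, map_intCast, norm_mul, hbnorm (Finset.mem_insert_of_mem hf),
          Complex.norm_intCast]
      · rw [Complex.norm_intCast]
    linarith
  have hB1 : 1 ≤ n * (1 + 2 * T) := one_le_mul_of_one_le_of_one_le hn1 (by linarith)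
  have hmain := one_le_abs_mul_pow K x hxint hx0 _ hconj
  have hmain' : 1 ≤ |s - m| * ((n : ℝ) ^ (d ^ ξ - 1) * (1 + 2 * T) ^ (d ^ ξ - 1)) := by
    rw [← mul_pow, ← hxs]
    refine hmain.trans (mul_le_mul_of_nonneg_left ?_ (abs_nonneg _))
    exact pow_le_pow_right₀ hB1 (Nat.sub_le_sub_right hrank' 1)
  have hexp : (n : ℝ) ^ (-(d : ℝ) ^ ξ + 1) = ((n : ℝ) ^ (d ^ ξ - 1))⁻¹ := by
    rw [← Real.rpow_natCast (n : ℝ), ← Real.rpow_neg (by positivity),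
      Nat.cast_sub (Nat.one_le_pow _ _ hd0.pos)]
    congr 1
    push_cast
    ring
  rw [ge_iff_le, hexp, ← mul_inv, distNearestInt, inv_le_iff_one_le_mul₀ (by positivity)]
  calc (1 : ℝ) ≤ _ := hmain'
    _ = _ := by ring
end

section
/- Let d ≥ 2 and ξ ≥ 1 be integers and let P_ξ^* be the set of integers of the form ∏_{j=1}^ξ p_j^{a_j} with each a_j ∈ {0, 1, …, d−1}, excluding 1, where p_j is the j-th prime. There exists a constant C > 0 (depending only on d and ξ) such that for every positive integer n and every real number α there exist integers c_f with 0 < c_f ≤ n for each f ∈ P_ξ^*, satisfying ‖ Σ_{f ∈ P_ξ^*} c_f · f^{1/d} − α ‖ ≤ C · n^{−d^ξ + 1}. -/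
/-- A real radical over `ℚ` which is irrational has trace zero in every real number field. -/
theorem trace_eq_zero_of_irrational_radical (K : IntermediateField ℚ ℝ) [FiniteDimensional ℚ K]
    (x : K) {d : ℕ} (hd : 0 < d) (q : ℚ) (hx : x ^ d = algebraMap ℚ K q)
    (hirr : ∀ r : ℚ, x ≠ algebraMap ℚ K r) : Algebra.trace ℚ K x = 0 := by
  classical
  have hex : ∃ k, 0 < k ∧ ∃ r : ℚ, x ^ k = algebraMap ℚ K r := ⟨d, hd, q, hx⟩
  obtain ⟨hk, r, hr⟩ := Nat.find_spec hex
  have hmin : ∀ m, 0 < m → (∃ r : ℚ, x ^ m = algebraMap ℚ K r) → Nat.find hex ≤ m :=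
    fun m h1 h2 => Nat.find_min' hex ⟨h1, h2⟩
  generalize Nat.find hex = k at hk hr hmin
  have hint : IsIntegral ℚ x := IsIntegral.of_finite ℚ x
  have hk1 : k ≠ 1 := by
    rintro rfl
    exact hirr r (by simpa using hr)
  set m := (minpoly ℚ x).natDegree with hm
  have hmpos : 0 < m := minpoly.natDegree_pos hint
  have hnorm : ∃ s : ℚ, x ^ m = algebraMap ℚ K s := by
    set g : IntermediateField.adjoin ℚ {x} := IntermediateField.AdjoinSimple.gen ℚ x with hg
    have hgr : g ^ k = algebraMap ℚ _ r := by
      apply Subtype.ext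
      simpa [hg] using hr
    have hN : Algebra.norm ℚ g ^ k = r ^ m := by
      rw [← map_pow, hgr, Algebra.norm_algebraMap, IntermediateField.adjoin.finrank hint]
    have hxr : (x : ℝ) ^ k = (r : ℝ) := by
      have := congrArg (fun z : K => (z : ℝ)) hr
      simpa using this
    have habs : |((Algebra.norm ℚ g : ℚ) : ℝ)| = |(x : ℝ) ^ m| := by
      refine (pow_left_inj₀ (abs_nonneg _) (abs_nonneg _) hk.ne').1 ?_
      rw [← abs_pow, ← abs_pow, ← pow_mul, mul_comm m k, pow_mul, hxr]
      exact_mod_cast congrArg abs hN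
    rcases abs_eq_abs.1 habs with h | h
    · exact ⟨Algebra.norm ℚ g, Subtype.ext (by simpa using h.symm)⟩
    · exact ⟨-Algebra.norm ℚ g, Subtype.ext (by simp [h])⟩
  have hkm := hmin m hmpos hnorm
  have hmonic : (Polynomial.X ^ k - Polynomial.C r : Polynomial ℚ).Monic :=
    Polynomial.monic_X_pow_sub_C r hk.ne'
  have hpoly : minpoly ℚ x = Polynomial.X ^ k - Polynomial.C r := by
    refine Polynomial.eq_of_monic_of_dvd_of_natDegree_le (minpoly.monic hint) hmonic
      (minpoly.dvd ℚ x (by simp [hr])) ?_ |>.symm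
    rw [Polynomial.natDegree_X_pow_sub_C]
    exact hkm
  rw [trace_eq_finrank_mul_minpoly_nextCoeff, hpoly, Polynomial.nextCoeff_of_natDegree_pos]
  · rw [Polynomial.natDegree_X_pow_sub_C]
    have h1 : k - 1 ≠ k := by omega
    have h2 : k - 1 ≠ 0 := by omega
    simp [Polynomial.coeff_X_pow, Polynomial.coeff_C, h1, h2]
  · rw [Polynomial.natDegree_X_pow_sub_C]; exact hk

/-- Positive real radicals with pairwise irrational ratios are linearly independent over `ℚ`. -/
theorem coeff_eq_zero_of_sum_radicals_eq_zero {ι : Type*} [Fintype ι] (θ : ι → ℝ) (hpos : ∀ a, 0 < θ a)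
    {d : ℕ} (hd : 0 < d) (F : ι → ℚ) (hF : ∀ a, θ a ^ d = F a)
    (hirr : ∀ a b, a ≠ b → ∀ r : ℚ, θ a ≠ r * θ b) (g : ι → ℚ)
    (hg : ∑ a, (g a : ℝ) * θ a = 0) : g = 0 := by
  classical
  let K : IntermediateField ℚ ℝ := IntermediateField.adjoin ℚ (Set.range θ)
  have hint : ∀ x ∈ Set.range θ, IsIntegral ℚ x := by
    rintro _ ⟨a, rfl⟩
    refine ⟨Polynomial.X ^ d - Polynomial.C (F a), Polynomial.monic_X_pow_sub_C _ hd.ne', ?_⟩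
    simp [hF]
  have : FiniteDimensional ℚ K := IntermediateField.finiteDimensional_adjoin hint
  let t : ι → K := fun a => ⟨θ a, IntermediateField.subset_adjoin ℚ _ ⟨a, rfl⟩⟩
  have ht0 : ∀ a, t a ≠ 0 := fun a h => (hpos a).ne' (congrArg Subtype.val h)
  funext b
  have hsum : ∑ a, g a • (t a / t b) = 0 := by
    have h : ∑ a, g a • t a = 0 := by
      apply Subtype.ext
      simpa [t, Rat.smul_def] using hg
    calc ∑ a, g a • (t a / t b) = (∑ a, g a • t a) / t b := by
          rw [Finset.sum_div]
          exact Finset.sum_congr rfl fun a _ => by rw [smul_div_assoc]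
      _ = 0 := by rw [h, zero_div]
  have htr := congrArg (Algebra.trace ℚ K) hsum
  rw [map_sum, map_zero, Finset.sum_eq_single b] at htr
  · rw [map_smul, div_self (ht0 b), ← map_one (algebraMap ℚ K), Algebra.trace_algebraMap] at htr
    simpa [Module.finrank_pos.ne'] using htr
  · intro a _ hab
    rw [map_smul, trace_eq_zero_of_irrational_radical K (t a / t b) hd (F a / F b), smul_zero]
    · apply Subtype.ext
      simp [t, div_pow, hF]
    · intro r hr
      apply hirr a b hab r
      have := congrArg (fun z : K => (z : ℝ)) hr
      simp only [t] at this
      have hb := (hpos b).ne'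
      simpa [div_eq_iff hb] using this
  · simp

/-- Dirichlet's theorem for one linear form, with the constant coefficient at index `0`. -/
theorem exists_small_linear_form {ι : Type*} [Fintype ι] [DecidableEq ι] [Zero ι] [Nontrivial ι]
    (θ : ι → ℝ) (h0 : θ 0 = 1) (n : ℕ) (hn : 1 ≤ n) :
    ∃ x : ι → ℤ, x ≠ 0 ∧ (∀ a, a ≠ 0 → |x a| ≤ n) ∧
      |∑ a, (x a : ℝ) * θ a| ≤ ((n : ℝ) ^ (Fintype.card ι - 1))⁻¹ := by
  classical
  set M := Fintype.card ι - 1 with hM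
  have hMpos : 0 < M := by have := Fintype.one_lt_card (α := ι); omega
  have hnM : 0 < n ^ M := pow_pos hn M
  have hcard : Fintype.card {a : ι // a ≠ 0} = M := by
    simp [hM, Fintype.card_subtype_compl]
  let L : ({a : ι // a ≠ 0} → Fin (n + 1)) → ℝ := fun u => ∑ a, ((u a : ℕ) : ℝ) * θ a
  have hfl : ∀ u, ⌊Int.fract (L u) * (n ^ M : ℕ)⌋₊ < n ^ M := by
    intro u
    rw [Nat.floor_lt (mul_nonneg (Int.fract_nonneg _) (Nat.cast_nonneg _))]
    have : (0 : ℝ) < (n ^ M : ℕ) := by exact_mod_cast hnM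
    nlinarith [Int.fract_lt_one (L u)]
  obtain ⟨u, v, huv, h⟩ := Fintype.exists_ne_map_eq_of_card_lt
    (fun u => (⟨_, hfl u⟩ : Fin (n ^ M))) (by
      simpa [hcard] using Nat.pow_lt_pow_left (Nat.lt_succ_self n) hMpos.ne')
  simp only [Fin.mk.injEq] at h
  have hclose : |Int.fract (L u) - Int.fract (L v)| ≤ ((n : ℝ) ^ M)⁻¹ := by
    have hp : (0 : ℝ) < (n ^ M : ℕ) := by exact_mod_cast hnM
    have h1 : ⌊Int.fract (L u) * (n ^ M : ℕ)⌋ = ⌊Int.fract (L v) * (n ^ M : ℕ)⌋ := by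
      rw [← Int.natCast_floor_eq_floor (mul_nonneg (Int.fract_nonneg _) hp.le),
        ← Int.natCast_floor_eq_floor (mul_nonneg (Int.fract_nonneg _) hp.le), h]
    have h2 := Int.abs_sub_lt_one_of_floor_eq_floor h1
    rw [← sub_mul, abs_mul, abs_of_pos hp] at h2
    rw [← one_div, le_div_iff₀ (by exact_mod_cast hnM)]
    exact_mod_cast h2.le
  let x : ι → ℤ := fun a =>
    if h : a = 0 then ⌊L v⌋ - ⌊L u⌋ else (u ⟨a, h⟩ : ℤ) - (v ⟨a, h⟩ : ℤ)
  have hxa : ∀ a : {a : ι // a ≠ 0}, x a = (u a : ℤ) - (v a : ℤ) := fun a => by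
    simp [x, a.2]
  refine ⟨x, ?_, ?_, ?_⟩
  · intro hx
    apply huv
    funext a
    have := (hxa a).symm.trans (congrFun hx a)
    apply Fin.ext
    simp only [Pi.zero_apply] at this
    omega
  · intro a ha
    rw [hxa ⟨a, ha⟩, abs_le]
    have := (u ⟨a, ha⟩).is_lt
    have := (v ⟨a, ha⟩).is_lt
    constructor <;> omega
  · have hsum : ∑ a, (x a : ℝ) * θ a = Int.fract (L u) - Int.fract (L v) := by
      rw [Fintype.sum_eq_add_sum_subtype_ne _ (0 : ι), h0]
      have : ∑ a : {a : ι // a ≠ 0}, (x a : ℝ) * θ a = L u - L v := by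
        simp only [L, ← Finset.sum_sub_distrib]
        refine Finset.sum_congr rfl fun a _ => ?_
        rw [hxa]; push_cast; ring
      rw [this]
      simp only [x, Int.fract]
      push_cast [dif_pos]
      ring
    rw [hsum]
    exact hclose

open Matrix in
/-- Integer combinations of a basis of a multiplicatively closed lattice approximate every
real vector, simultaneously in the coordinates and in the linear form `θ`. -/
theorem exists_int_vector_near {ι : Type*} [Fintype ι] [AddCommGroup ι] [Nontrivial ι]
    (θ : ι → ℝ) (h0 : θ 0 = 1) (hind : ∀ g : ι → ℤ, ∑ a, (g a : ℝ) * θ a = 0 → g = 0)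
    (m : ι → ι → ℤ) (hm : ∀ a b, θ a * θ b = m a b * θ (a + b)) :
    ∃ D : ℕ, ∃ S : ℝ, ∀ n : ℕ, 1 ≤ n → ∀ y : ι → ℝ, ∃ c : ι → ℤ,
      (∀ a, |c a - y a| ≤ D * n) ∧
      |∑ a, (c a : ℝ) * θ a - ∑ a, y a * θ a| ≤ S * ((n : ℝ) ^ (Fintype.card ι - 1))⁻¹ := by
  classical
  set A : ℝ := 1 + ∑ a, |θ a| with hA
  have hA1 : 1 ≤ A := by
    have : 0 ≤ ∑ a, |θ a| := Finset.sum_nonneg fun _ _ => abs_nonneg _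
    linarith
  obtain ⟨D, hD⟩ := exists_nat_ge (∑ p : ι × ι, |(m p.1 p.2 : ℝ)| * A)
  refine ⟨D, ∑ a, |θ a|, fun n hn y => ?_⟩
  have hn1 : (1 : ℝ) ≤ n := by exact_mod_cast hn
  obtain ⟨x, hx0, hxn, hxs⟩ := exists_small_linear_form θ h0 n hn
  set β := ∑ a, (x a : ℝ) * θ a with hβ
  have hβ0 : β ≠ 0 := fun h => hx0 (hind x h)
  have hxA : ∀ a, |(x a : ℝ)| ≤ A * n := by
    have hle : ∀ a, a ≠ 0 → |(x a : ℝ)| ≤ n := fun a ha => by exact_mod_cast hxn a ha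
    intro a
    by_cases ha : a = 0
    · subst ha
      have hsum : (x 0 : ℝ) = β - ∑ a : {a : ι // a ≠ 0}, (x a : ℝ) * θ a := by
        rw [hβ, Fintype.sum_eq_add_sum_subtype_ne _ (0 : ι), h0]; ring
      have hβ1 : |β| ≤ 1 := hxs.trans (inv_le_one_of_one_le₀ (one_le_pow₀ hn1))
      have hs : |∑ a : {a : ι // a ≠ 0}, (x a : ℝ) * θ a| ≤ ∑ a, |θ a| * n := by
        refine (Finset.abs_sum_le_sum_abs _ _).trans ?_
        rw [Fintype.sum_eq_add_sum_subtype_ne (fun a => |θ a| * n) (0 : ι)]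
        refine le_add_of_nonneg_of_le (by positivity) (Finset.sum_le_sum fun a _ => ?_)
        rw [abs_mul, mul_comm]
        exact mul_le_mul_of_nonneg_left (hle a a.2) (abs_nonneg _)
      rw [← Finset.sum_mul] at hs
      rw [hsum, hA, add_mul]
      refine (abs_sub _ _).trans ?_
      linarith
    · exact (hle a ha).trans (by nlinarith)
  let V : Matrix ι ι ℤ := fun b c => m (c - b) b * x (c - b)
  have hVθ : ∀ b, ∑ c, (V b c : ℝ) * θ c = θ b * β := by
    intro b
    rw [hβ, Finset.mul_sum, ← Equiv.sum_comp (Equiv.addRight b)]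
    refine Finset.sum_congr rfl fun a _ => ?_
    simp only [V, Equiv.coe_addRight, add_sub_cancel_right]
    push_cast
    linear_combination (-(x a : ℝ)) * hm a b
  have hVsum : ∀ b c, |(V b c : ℝ)| ≤ |(m (c - b) b : ℝ)| * A * n := by
    intro b c
    simp only [V]
    push_cast
    rw [abs_mul, mul_assoc]
    exact mul_le_mul_of_nonneg_left (hxA _) (abs_nonneg _)
  have hcomb : ∀ w : ι → ℝ, ∑ c, (∑ b, w b * V b c) * θ c = (∑ b, w b * θ b) * β := by
    intro w
    simp_rw [Finset.sum_mul]
    rw [Finset.sum_comm]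
    refine Finset.sum_congr rfl fun b _ => ?_
    rw [mul_assoc, ← hVθ, Finset.mul_sum]
    exact Finset.sum_congr rfl fun c _ => by ring
  have hdet : V.det ≠ 0 := by
    intro h
    obtain ⟨g, hg0, hg⟩ := Matrix.exists_vecMul_eq_zero_iff.2 h
    apply hg0
    apply hind
    have h1 := hcomb (fun b => g b)
    have h2 : ∀ c, ∑ b, (g b : ℝ) * V b c = 0 := fun c => by
      have := congrFun hg c
      simp only [Matrix.vecMul, dotProduct, Pi.zero_apply] at this
      exact_mod_cast this
    simp only [h2, zero_mul, Finset.sum_const_zero] at h1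
    exact (mul_eq_zero.1 h1.symm).resolve_right hβ0
  let W : Matrix ι ι ℝ := V.map (Int.castRingHom ℝ)
  have hW : IsUnit W.det := by
    rw [show W.det = (V.det : ℝ) from (RingHom.map_det (Int.castRingHom ℝ) V).symm]
    exact isUnit_iff_ne_zero.2 (by exact_mod_cast hdet)
  set t := y ᵥ* W⁻¹ with ht
  have hty : ∀ c, ∑ b, t b * V b c = y c := by
    intro c
    have : t ᵥ* W = y := by rw [ht, Matrix.vecMul_vecMul, Matrix.nonsing_inv_mul _ hW,
      Matrix.vecMul_one]
    exact congrFun this c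
  have hdiff : ∀ b, |(⌊t b⌋ : ℝ) - t b| ≤ 1 := fun b => by
    rw [abs_le]
    constructor <;> linarith [Int.floor_le (t b), Int.lt_floor_add_one (t b)]
  have hcy : ∀ a, ((∑ b, ⌊t b⌋ * V b a : ℤ) : ℝ) - y a = ∑ b, ((⌊t b⌋ : ℝ) - t b) * V b a := by
    intro a
    rw [← hty a]
    push_cast
    rw [← Finset.sum_sub_distrib]
    exact Finset.sum_congr rfl fun b _ => by ring
  refine ⟨fun a => ∑ b, ⌊t b⌋ * V b a, fun a => ?_, ?_⟩
  · rw [hcy]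
    calc |∑ b, ((⌊t b⌋ : ℝ) - t b) * V b a| ≤ ∑ b, |(m (a - b) b : ℝ)| * A * n := by
          refine (Finset.abs_sum_le_sum_abs _ _).trans (Finset.sum_le_sum fun b _ => ?_)
          rw [abs_mul]
          exact (mul_le_of_le_one_left (abs_nonneg _) (hdiff b)).trans (hVsum b a)
      _ = (∑ b, |(m (a - b) b : ℝ)| * A) * n := by rw [Finset.sum_mul]
      _ ≤ (∑ p : ι × ι, |(m p.1 p.2 : ℝ)| * A) * n := by
          refine mul_le_mul_of_nonneg_right ?_ (by positivity)
          rw [Fintype.sum_prod_type_right]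
          refine Finset.sum_le_sum fun b _ => ?_
          exact Finset.single_le_sum (f := fun c => |(m c b : ℝ)| * A)
            (fun c _ => by positivity) (Finset.mem_univ (a - b))
      _ ≤ D * n := mul_le_mul_of_nonneg_right hD (by positivity)
  · rw [← Finset.sum_sub_distrib]
    simp_rw [← sub_mul, hcy]
    rw [hcomb, abs_mul]
    refine mul_le_mul ?_ hxs (abs_nonneg _) (Finset.sum_nonneg fun _ _ => abs_nonneg _)
    refine (Finset.abs_sum_le_sum_abs _ _).trans (Finset.sum_le_sum fun b _ => ?_)
    rw [abs_mul]
    exact mul_le_of_le_one_left (abs_nonneg _) (hdiff b)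

/-- Inhomogeneous approximation with positive bounded coefficients, with the optimal exponent. -/
theorem exists_pos_bounded_coeff_approx {ι : Type*} [Fintype ι] [AddCommGroup ι] [Nontrivial ι]
    (θ : ι → ℝ) (h0 : θ 0 = 1) (hind : ∀ g : ι → ℤ, ∑ a, (g a : ℝ) * θ a = 0 → g = 0)
    (m : ι → ι → ℤ) (hm : ∀ a b, θ a * θ b = m a b * θ (a + b)) :
    ∃ C : ℝ, 0 < C ∧ ∀ n : ℕ, 1 ≤ n → ∀ α : ℝ, ∃ c : ι → ℤ,
      (∀ a, a ≠ 0 → 0 < c a ∧ c a ≤ n) ∧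
      |∑ a, (c a : ℝ) * θ a - α| ≤ C * ((n : ℝ) ^ (Fintype.card ι - 1))⁻¹ := by
  classical
  obtain ⟨D, S, hDS⟩ := exists_int_vector_near θ h0 hind m hm
  set M := Fintype.card ι - 1
  have hS : 0 ≤ S := by
    obtain ⟨c, -, hc⟩ := hDS 1 le_rfl 0
    simpa using (abs_nonneg _).trans hc
  set T : ℕ := 2 * D + 1 with hT
  have hTpos : (0 : ℝ) < T := by positivity
  refine ⟨(S + 1) * (2 * T) ^ M, by positivity, fun n hn α => ?_⟩
  have hnpos : (0 : ℝ) < n := by exact_mod_cast hn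
  have hsplit : ∀ z : ι → ℝ, ∑ a, z a * θ a = z 0 + ∑ a : {a : ι // a ≠ 0}, z a * θ a := by
    intro z
    rw [Fintype.sum_eq_add_sum_subtype_ne _ (0 : ι), h0, mul_one]
  have hbound : ∀ k : ℝ, 0 < k → (n : ℝ) ≤ 2 * T * k → ∀ s, 0 ≤ s → s ≤ S + 1 →
      s * (k ^ M)⁻¹ ≤ (S + 1) * (2 * T) ^ M * ((n : ℝ) ^ M)⁻¹ := by
    intro k hk hnk s hs0 hs
    rw [mul_assoc, ← div_eq_mul_inv ((2 * (T : ℝ)) ^ M), ← div_pow, ← inv_pow]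
    refine mul_le_mul hs (pow_le_pow_left₀ (by positivity) ?_ _) (by positivity) (by positivity)
    rw [inv_eq_one_div, div_le_div_iff₀ hk hnpos]
    linarith
  rcases lt_or_ge n T with hlt | hge
  · have hlt' : (n : ℝ) < T := by exact_mod_cast hlt
    set σ := ∑ a : {a : ι // a ≠ 0}, (1 : ℝ) * θ a
    refine ⟨fun a => if a = 0 then ⌊α - σ⌋ else 1, fun a ha => ?_, ?_⟩
    · simpa [ha] using hn
    · have h1 : ∑ a, ((if a = 0 then ⌊α - σ⌋ else 1 : ℤ) : ℝ) * θ a = ⌊α - σ⌋ + σ := by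
        rw [hsplit]
        simp only [if_true, σ]
        congr 1
        exact Finset.sum_congr rfl fun a _ => by simp [a.2]
      rw [h1]
      refine le_trans ?_ (hbound 1 one_pos (by linarith) 1 zero_le_one (by linarith))
      rw [one_pow, inv_one, mul_one, abs_le]
      constructor <;> linarith [Int.floor_le (α - σ), Int.lt_floor_add_one (α - σ)]
  · set k := n / T with hk
    have hk1 : 1 ≤ k := Nat.div_pos hge (by omega)
    have hTk : T * k ≤ n := Nat.mul_div_le n T
    have hkT : n ≤ 2 * T * k := by
      have h1 : n < T * (k + 1) := Nat.lt_mul_div_succ n (by omega)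
      nlinarith
    have hkpos : (0 : ℝ) < k := by exact_mod_cast hk1
    have hTk' : (2 * (D : ℝ) + 1) * k ≤ n := by exact_mod_cast hTk
    set σ := ∑ a : {a : ι // a ≠ 0}, ((n : ℝ) / 2) * θ a
    obtain ⟨c, hc1, hc2⟩ := hDS k hk1 (fun a => if a = 0 then α - σ else (n : ℝ) / 2)
    have h1 : ∑ a, (if a = 0 then α - σ else (n : ℝ) / 2) * θ a = α := by
      rw [hsplit]
      simp only [if_true, σ]
      rw [sub_add_eq_add_sub, sub_eq_iff_eq_add]
      congr 1
      exact Finset.sum_congr rfl fun a _ => by simp [a.2]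
    refine ⟨c, fun a ha => ?_, ?_⟩
    · have h2 := hc1 a
      simp only [if_neg ha] at h2
      rw [abs_le] at h2
      constructor
      · have : (0 : ℝ) < c a := by nlinarith
        exact_mod_cast this
      · have : (c a : ℝ) ≤ n := by nlinarith
        exact_mod_cast this
    · rw [h1] at hc2
      exact hc2.trans (hbound k hkpos (by exact_mod_cast hkT) S hS (by linarith))

/-- The product `∏ p_j ^ a_j` over the first `ξ` primes. -/
noncomputable def primeProd {d ξ : ℕ} (a : Fin ξ → Fin d) : ℕ :=
  ∏ j : Fin ξ, (Nat.nth Nat.Prime (j : ℕ)) ^ ((a j : ℕ))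

theorem primeProd_pos {d ξ : ℕ} (a : Fin ξ → Fin d) : 0 < primeProd a :=
  Finset.prod_pos fun j _ => pow_pos (Nat.prime_nth_prime j).pos _

theorem factorization_primeProd {d ξ : ℕ} (a : Fin ξ → Fin d) (i : Fin ξ) :
    (primeProd a).factorization (Nat.nth Nat.Prime i) = a i := by
  have hinj : ∀ j : Fin ξ, Nat.nth Nat.Prime j = Nat.nth Nat.Prime i ↔ j = i := fun j =>
    ((Nat.nth_injective Nat.infinite_setOfPred_prime).eq_iff).trans Fin.ext_iff.symm
  rw [primeProd, Nat.factorization_prod (g := fun j : Fin ξ => Nat.nth Nat.Prime j ^ (a j : ℕ))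
    fun j _ => pow_ne_zero _ (Nat.prime_nth_prime j).ne_zero]
  simp [Finsupp.single_apply, hinj]

theorem primeProd_zero {d ξ : ℕ} [NeZero d] : primeProd (0 : Fin ξ → Fin d) = 1 := by
  simp [primeProd]

theorem primeProd_mul {d ξ : ℕ} [NeZero d] (a b : Fin ξ → Fin d) :
    primeProd a * primeProd b =
      (∏ j : Fin ξ, Nat.nth Nat.Prime j ^ (((a j : ℕ) + b j) / d)) ^ d * primeProd (a + b) := by
  simp only [primeProd, ← Finset.prod_mul_distrib, ← Finset.prod_pow]
  refine Finset.prod_congr rfl fun j _ => ?_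
  rw [← pow_add, ← pow_mul, ← pow_add, Pi.add_apply, Fin.val_add, Nat.div_add_mod']

theorem eq_of_primeProd_eq_rat_pow_mul {d ξ : ℕ} (a b : Fin ξ → Fin d) (r : ℚ)
    (h : (primeProd a : ℚ) = r ^ d * primeProd b) : a = b := by
  funext i
  have : Fact (Nat.nth Nat.Prime i).Prime := ⟨Nat.prime_nth_prime i⟩
  have ha : (primeProd a : ℚ) ≠ 0 := by exact_mod_cast (primeProd_pos a).ne'
  have hb : (primeProd b : ℚ) ≠ 0 := by exact_mod_cast (primeProd_pos b).ne'
  have hr : r ^ d ≠ 0 := fun h0 => ha (by rw [h, h0, zero_mul])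
  have hval := congrArg (padicValRat (Nat.nth Nat.Prime i)) h
  rw [padicValRat.mul hr hb, padicValRat.pow, padicValRat.of_nat, padicValRat.of_nat,
    ← Nat.factorization_def _ (Nat.prime_nth_prime i),
    ← Nat.factorization_def _ (Nat.prime_nth_prime i),
    factorization_primeProd, factorization_primeProd] at hval
  apply Fin.ext
  have h1 := (a i).is_lt
  have h2 := (b i).is_lt
  have hmod := congrArg (· % (d : ℤ)) hval
  simp only [Int.mul_add_emod_self_left] at hmod
  rw [Int.emod_eq_of_lt (by omega) (by omega), Int.emod_eq_of_lt (by omega) (by omega)] at hmod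
  exact_mod_cast hmod

theorem primeProd_injective {d ξ : ℕ} :
    Function.Injective (primeProd : (Fin ξ → Fin d) → ℕ) := fun a b h =>
  eq_of_primeProd_eq_rat_pow_mul a b 1 (by simp [h])

theorem stmt_14 (d ξ : ℕ) (hd : 2 ≤ d) (hξ : 1 ≤ ξ) :
    ∃ C : ℝ, 0 < C ∧ ∀ (n : ℕ), 1 ≤ n → ∀ α : ℝ,
      ∃ c : ℕ → ℤ, (∀ f ∈ PstarSet d ξ, 0 < c f ∧ c f ≤ (n : ℤ)) ∧
        distNearestInt ((∑ f ∈ PstarSet d ξ, (c f : ℝ) * (f : ℝ) ^ ((d : ℝ)⁻¹)) - α) ≤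
          C * (n : ℝ) ^ (-(d : ℝ) ^ ξ + 1) := by
  classical
  have : NeZero d := ⟨by omega⟩
  have : Nontrivial (Fin d) := Fin.nontrivial_iff_two_le.2 hd
  have : Nonempty (Fin ξ) := ⟨⟨0, hξ⟩⟩
  have hd0 : d ≠ 0 := by omega
  let θ : (Fin ξ → Fin d) → ℝ := fun a => (primeProd a : ℝ) ^ ((d : ℝ)⁻¹)
  have hpos : ∀ a, 0 < θ a := fun a =>
    Real.rpow_pos_of_pos (by exact_mod_cast primeProd_pos a) _
  have hpow : ∀ a, θ a ^ d = (primeProd a : ℝ) := fun a =>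
    Real.rpow_inv_natCast_pow (Nat.cast_nonneg _) hd0
  have h0 : θ 0 = 1 := by simp [θ, primeProd_zero]
  have hind : ∀ g : (Fin ξ → Fin d) → ℤ, ∑ a, (g a : ℝ) * θ a = 0 → g = 0 := by
    intro g hg
    have := coeff_eq_zero_of_sum_radicals_eq_zero θ hpos (by omega : 0 < d)
      (fun a => (primeProd a : ℚ)) (fun a => by simp [hpow])
      (fun a b hab r h => hab (eq_of_primeProd_eq_rat_pow_mul a b r (by
        have h1 := congrArg (· ^ d) h
        simp only [mul_pow, hpow] at h1
        exact_mod_cast h1)))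
      (fun a => (g a : ℚ)) (by simpa using hg)
    funext a
    simpa using congrFun this a
  obtain ⟨C, hC, happ⟩ := exists_pos_bounded_coeff_approx θ h0 hind
    (fun a b => ((∏ j : Fin ξ, Nat.nth Nat.Prime j ^ (((a j : ℕ) + b j) / d) : ℕ) : ℤ)) (by
      intro a b
      refine (pow_left_inj₀ (mul_pos (hpos a) (hpos b)).le
        (mul_nonneg (by positivity) (hpos _).le) hd0).1 ?_
      rw [mul_pow, mul_pow, hpow, hpow, hpow, Int.cast_natCast]
      exact_mod_cast primeProd_mul a b)
  refine ⟨C, hC, fun n hn α => ?_⟩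
  obtain ⟨c, hc1, hc2⟩ := happ n hn α
  have hset : PstarSet d ξ = (Finset.univ.erase (0 : Fin ξ → Fin d)).image primeProd := by
    rw [Finset.image_erase primeProd_injective, primeProd_zero]
    rfl
  have hext : ∀ a, Function.extend primeProd c 0 (primeProd a) = c a :=
    primeProd_injective.extend_apply c 0
  refine ⟨Function.extend primeProd c 0, fun f hf => ?_, ?_⟩
  · rw [hset, Finset.mem_image] at hf
    obtain ⟨a, ha, rfl⟩ := hf
    rw [hext]
    exact hc1 a (Finset.ne_of_mem_erase ha)
  · have hexp : (n : ℝ) ^ (-(d : ℝ) ^ ξ + 1) =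
        ((n : ℝ) ^ (Fintype.card (Fin ξ → Fin d) - 1))⁻¹ := by
      rw [← Real.rpow_natCast (n : ℝ), ← Real.rpow_neg (Nat.cast_nonneg _)]
      congr 1
      rw [Nat.cast_sub Fintype.card_pos]
      simp
      ring
    rw [hexp, hset, Finset.sum_image primeProd_injective.injOn]
    simp_rw [hext]
    refine le_trans (round_le _ (-c 0)) ?_
    refine le_of_eq_of_le ?_ hc2
    rw [← Finset.add_sum_erase Finset.univ _ (Finset.mem_univ (0 : Fin ξ → Fin d)), h0]
    congr 1
    push_cast
    ring
end
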